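/- arXiv:2207.00201 — 6 statements merged into one kernel-verified Lean document; each statement's English description precedes it below -/
import Mathlib

section
/- Let 0 < H < 1 and K ∈ (0,1) ∪ (1,2) with HK ∈ (0,1). Define R(t,s) = (Γ(1−K)/(K(2−K)))·[t^{2HK} + s^{2HK} − (t^{2H} + s^{2H})^K] when K ∈ (0,1), and R(t,s) = (Γ(2−K)/(K(K−1)))·[(t^{2H} + s^{2H})^K − t^{2HK} − s^{2HK}] when K ∈ (1,2). Then for any n ≥ 1 and any strictly increasing times 0 < t₁ < t₂ < ⋯ < t_n, the n×n matrix V with entries V_{ij} = R(t_i, t_j) is strictly positive definite. -/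
open Matrix Real

open MeasureTheory Set

/-- A function that is `O(u ^ b)` on `(0, 1]` and `O(u ^ a)` on `(1, ∞)` is integrable against
`u ^ (-1 - K)` on `(0, ∞)` when `a < K < b`. -/
lemma integrableOn_Ioi_mul_rpow_of_bounds {φ : ℝ → ℝ} (hφ : Continuous φ) {a b K : ℝ}
    (haK : a < K) (hKb : K < b) (hb : ∀ u ∈ Ioc (0 : ℝ) 1, |φ u| ≤ u ^ b)
    (ha : ∀ u ∈ Ioi (1 : ℝ), |φ u| ≤ u ^ a) :
    IntegrableOn (fun u => φ u * u ^ (-1 - K)) (Ioi 0) := by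
  have hmeas : Measurable fun u : ℝ => φ u * u ^ (-1 - K) :=
    hφ.measurable.mul (measurable_id.pow_const _)
  rw [← Ioc_union_Ioi_eq_Ioi (zero_le_one' ℝ)]
  refine IntegrableOn.union ?_ ?_
  · have h : IntegrableOn (fun u : ℝ => u ^ (b + (-1 - K))) (Ioc 0 1) := by
      rw [← intervalIntegrable_iff_integrableOn_Ioc_of_le zero_le_one]
      exact intervalIntegral.intervalIntegrable_rpow' (by linarith)
    refine h.mono' hmeas.aestronglyMeasurable (ae_restrict_of_forall_mem measurableSet_Ioc ?_)
    intro u hu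
    rw [norm_mul, Real.norm_eq_abs, Real.norm_of_nonneg (rpow_nonneg hu.1.le _), rpow_add hu.1]
    exact mul_le_mul_of_nonneg_right (hb u hu) (rpow_nonneg hu.1.le _)
  · have h : IntegrableOn (fun u : ℝ => u ^ (a + (-1 - K))) (Ioi 1) :=
      integrableOn_Ioi_rpow_of_lt (by linarith) one_pos
    refine h.mono' hmeas.aestronglyMeasurable (ae_restrict_of_forall_mem measurableSet_Ioi ?_)
    intro u hu
    have hu0 : (0 : ℝ) < u := one_pos.trans hu
    rw [norm_mul, Real.norm_eq_abs, Real.norm_of_nonneg (rpow_nonneg hu0.le _), rpow_add hu0]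
    exact mul_le_mul_of_nonneg_right (ha u hu) (rpow_nonneg hu0.le _)

lemma comp_mul_left_mul_rpow_eq (φ : ℝ → ℝ) (K : ℝ) {x u : ℝ} (hx : 0 < x) (hu : 0 < u) :
    φ (x * u) * u ^ (-1 - K) = x ^ (1 + K) * (φ (x * u) * (x * u) ^ (-1 - K)) := by
  have h : x ^ (1 + K) * x ^ (-1 - K) = 1 := by
    rw [← rpow_add hx]; simp
  rw [mul_rpow hx.le hu.le]
  linear_combination (-(φ (x * u) * u ^ (-1 - K))) * h

lemma integrableOn_Ioi_comp_mul_left_mul_rpow {φ : ℝ → ℝ} {K x : ℝ} (hx : 0 < x)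
    (h : IntegrableOn (fun u => φ u * u ^ (-1 - K)) (Ioi 0)) :
    IntegrableOn (fun u => φ (x * u) * u ^ (-1 - K)) (Ioi 0) := by
  have h' : IntegrableOn (fun u => φ (x * u) * (x * u) ^ (-1 - K)) (Ioi 0) :=
    (integrableOn_Ioi_comp_mul_left_iff (fun u => φ u * u ^ (-1 - K)) 0 hx).2 (by simpa using h)
  exact IntegrableOn.congr_fun (h'.const_mul (x ^ (1 + K)))
    (fun u hu => (comp_mul_left_mul_rpow_eq φ K hx hu).symm) measurableSet_Ioi

/-- Integrating against the homogeneous weight `u ^ (-1 - K)` turns a dilation by `x` into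
multiplication by `x ^ K`. -/
lemma integral_Ioi_comp_mul_left_mul_rpow (φ : ℝ → ℝ) {K x : ℝ} (hx : 0 < x) :
    ∫ u in Ioi (0 : ℝ), φ (x * u) * u ^ (-1 - K)
      = x ^ K * ∫ u in Ioi (0 : ℝ), φ u * u ^ (-1 - K) := by
  rw [setIntegral_congr_fun measurableSet_Ioi
      (fun u hu => comp_mul_left_mul_rpow_eq φ K hx hu), integral_const_mul,
    integral_comp_mul_left_Ioi (fun u => φ u * u ^ (-1 - K)) 0 hx, mul_zero, smul_eq_mul,
    rpow_add hx, rpow_one]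
  field_simp

/-- The functions `u ↦ 1 - exp (-(x i * u))` are linearly independent on `(0, ∞)` when the rates
`x i` are positive and distinct. -/
lemma eq_zero_of_sum_mul_one_sub_exp_eq_zero {n : ℕ} {x : Fin n → ℝ} (hx : ∀ i, 0 < x i)
    (hinj : Function.Injective x) {c : Fin n → ℝ}
    (h : ∀ u : ℝ, 0 < u → ∑ i, c i * (1 - exp (-(x i * u))) = 0) : c = 0 := by
  have h0 : ∀ m : ℕ, ∑ i, c i * (1 - exp (-x i) ^ m) = 0 := by
    intro m
    rcases Nat.eq_zero_or_pos m with rfl | hm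
    · simp
    · rw [← h m (by exact_mod_cast hm)]
      refine Finset.sum_congr rfl fun i _ => ?_
      rw [← exp_nat_mul]
      ring_nf
  have hv : (fun i => c i * (1 - exp (-x i))) = 0 := by
    refine eq_zero_of_forall_pow_sum_mul_pow_eq_zero (f := fun i => exp (-x i))
      (fun i j hij => hinj (neg_injective (exp_injective hij))) fun m => ?_
    rw [← sub_self (0 : ℝ)]
    nth_rw 1 [← h0 (m + 1)]
    rw [← h0 m, ← Finset.sum_sub_distrib]
    refine Finset.sum_congr rfl fun i _ => ?_
    ring
  funext i
  refine (mul_eq_zero.1 (congrFun hv i)).resolve_right (sub_ne_zero.2 (ne_of_gt ?_))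
  exact exp_lt_one_iff.2 (neg_neg_of_pos (hx i))

/-- If `(1 - exp (-x)) (1 - exp (-y))` is `ε` times the additivity defect of a nonnegative `φ`
which is integrable against `u ^ (-1 - K)`, then `ε (x ^ K + y ^ K - (x + y) ^ K)` is a strictly
positive definite kernel on `(0, ∞)`. -/
lemma posDef_rpow_add_rpow_sub_add_rpow {φ : ℝ → ℝ} {ε K : ℝ}
    (hφ0 : ∀ u, 0 < u → 0 ≤ φ u)
    (hφ : ∀ x y, ε * (φ x + φ y - φ (x + y)) = (1 - exp (-x)) * (1 - exp (-y)))
    (hint : IntegrableOn (fun u => φ u * u ^ (-1 - K)) (Ioi 0))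
    {n : ℕ} {x : Fin n → ℝ} (hx : ∀ i, 0 < x i) (hinj : Function.Injective x) :
    (Matrix.of fun i j : Fin n => ε * (x i ^ K + x j ^ K - (x i + x j) ^ K)).PosDef := by
  have hexp : ∀ (i j : Fin n) (u : ℝ),
      (1 - exp (-(x i * u))) * (1 - exp (-(x j * u))) * u ^ (-1 - K)
        = ε * (φ (x i * u) * u ^ (-1 - K) + φ (x j * u) * u ^ (-1 - K)
          - φ ((x i + x j) * u) * u ^ (-1 - K)) := by
    intro i j u
    rw [← hφ, add_mul (x i)]
    ring
  have hI : ∀ y : ℝ, 0 < y → IntegrableOn (fun u => φ (y * u) * u ^ (-1 - K)) (Ioi 0) :=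
    fun y hy => integrableOn_Ioi_comp_mul_left_mul_rpow hy hint
  have hadd : ∀ i j, 0 < x i + x j := fun i j => add_pos (hx i) (hx j)
  have hgint : ∀ i j : Fin n, IntegrableOn
      (fun u => (1 - exp (-(x i * u))) * (1 - exp (-(x j * u))) * u ^ (-1 - K)) (Ioi 0) := by
    intro i j
    simp_rw [hexp]
    exact (((hI _ (hx i)).add (hI _ (hx j))).sub (hI _ (hadd i j))).const_mul ε
  set J := ∫ u in Ioi (0 : ℝ), φ u * u ^ (-1 - K) with hJ
  have hgval : ∀ i j : Fin n,
      ∫ u in Ioi (0 : ℝ), (1 - exp (-(x i * u))) * (1 - exp (-(x j * u))) * u ^ (-1 - K)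
        = J * (ε * (x i ^ K + x j ^ K - (x i + x j) ^ K)) := by
    intro i j
    simp_rw [hexp]
    have hsum : IntegrableOn
        (fun u => φ (x i * u) * u ^ (-1 - K) + φ (x j * u) * u ^ (-1 - K)) (Ioi 0) :=
      (hI _ (hx i)).add (hI _ (hx j))
    rw [integral_const_mul, integral_sub hsum (hI _ (hadd i j)),
      integral_add (hI _ (hx i)) (hI _ (hx j)), integral_Ioi_comp_mul_left_mul_rpow φ (hx i),
      integral_Ioi_comp_mul_left_mul_rpow φ (hx j),
      integral_Ioi_comp_mul_left_mul_rpow φ (hadd i j), ← hJ]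
    ring
  have hJ0 : 0 ≤ J := setIntegral_nonneg measurableSet_Ioi fun u hu =>
    mul_nonneg (hφ0 u hu) (rpow_nonneg (le_of_lt hu) _)
  refine PosDef.of_dotProduct_mulVec_pos ?_ fun c hc => ?_
  · ext i j
    simp [add_comm]
  have hsq : ∀ u : ℝ, (∑ i, c i * (1 - exp (-(x i * u)))) ^ 2 * u ^ (-1 - K)
      = ∑ i, ∑ j, c i * c j *
        ((1 - exp (-(x i * u))) * (1 - exp (-(x j * u))) * u ^ (-1 - K)) := by
    intro u
    rw [sq, Finset.sum_mul_sum, Finset.sum_mul]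
    refine Finset.sum_congr rfl fun i _ => ?_
    rw [Finset.sum_mul]
    exact Finset.sum_congr rfl fun j _ => by ring
  have hFint : IntegrableOn
      (fun u => (∑ i, c i * (1 - exp (-(x i * u)))) ^ 2 * u ^ (-1 - K)) (Ioi 0) := by
    simp_rw [hsq]
    exact integrable_finsetSum _ fun i _ => integrable_finsetSum _ fun j _ =>
      (hgint i j).const_mul _
  have hFval : ∫ u in Ioi (0 : ℝ), (∑ i, c i * (1 - exp (-(x i * u)))) ^ 2 * u ^ (-1 - K)
      = J * (star c ⬝ᵥ
        ((Matrix.of fun i j : Fin n => ε * (x i ^ K + x j ^ K - (x i + x j) ^ K)) *ᵥ c)) := by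
    simp_rw [hsq]
    rw [integral_finsetSum _ fun i _ => integrable_finsetSum _ fun j _ =>
      (hgint i j).const_mul _]
    simp only [dotProduct, mulVec, Matrix.of_apply, Pi.star_apply, star_trivial, Finset.mul_sum]
    refine Finset.sum_congr rfl fun i _ => ?_
    rw [integral_finsetSum _ fun j _ => (hgint i j).const_mul _]
    refine Finset.sum_congr rfl fun j _ => ?_
    rw [integral_const_mul, hgval]
    ring
  have hF0 : ∀ u ∈ Ioi (0 : ℝ),
      0 ≤ (∑ i, c i * (1 - exp (-(x i * u)))) ^ 2 * u ^ (-1 - K) :=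
    fun u hu => mul_nonneg (sq_nonneg _) (rpow_nonneg (le_of_lt hu) _)
  have hFne : ∫ u in Ioi (0 : ℝ),
      (∑ i, c i * (1 - exp (-(x i * u)))) ^ 2 * u ^ (-1 - K) ≠ 0 := by
    intro h
    rw [setIntegral_eq_zero_iff_of_nonneg_ae
      (ae_restrict_of_forall_mem measurableSet_Ioi hF0) hFint] at h
    have hcont : ContinuousOn
        (fun u : ℝ => (∑ i, c i * (1 - exp (-(x i * u)))) ^ 2 * u ^ (-1 - K)) (Ioi 0) := by
      refine ContinuousOn.mul (by fun_prop) fun u hu => ?_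
      exact (continuousAt_rpow_const u _ (Or.inl (ne_of_gt hu))).continuousWithinAt
    have heq := Measure.eqOn_open_of_ae_eq h isOpen_Ioi hcont continuousOn_const
    refine hc (eq_zero_of_sum_mul_one_sub_exp_eq_zero hx hinj fun u hu => ?_)
    exact pow_eq_zero_iff two_ne_zero |>.1
      ((mul_eq_zero.1 (heq hu)).resolve_right (rpow_pos_of_pos hu _).ne')
  have hpos := (setIntegral_nonneg measurableSet_Ioi hF0).lt_of_ne' hFne
  rw [hFval] at hpos
  exact pos_of_mul_pos_right hpos hJ0

lemma posDef_rpow_kernel_of_lt_one {K : ℝ} (hK0 : 0 < K) (hK1 : K < 1) {n : ℕ}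
    {x : Fin n → ℝ} (hx : ∀ i, 0 < x i) (hinj : Function.Injective x) :
    (Matrix.of fun i j : Fin n => x i ^ K + x j ^ K - (x i + x j) ^ K).PosDef := by
  have h0 : ∀ u : ℝ, 0 < u → 0 ≤ 1 - exp (-u) := fun u hu =>
    sub_nonneg.2 (exp_le_one_iff.2 (neg_nonpos.2 hu.le))
  have hint : IntegrableOn (fun u : ℝ => (1 - exp (-u)) * u ^ (-1 - K)) (Ioi 0) := by
    refine integrableOn_Ioi_mul_rpow_of_bounds (by fun_prop) hK0 hK1 (fun u hu => ?_)
      fun u hu => ?_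
    · rw [abs_of_nonneg (h0 u hu.1), rpow_one]
      linarith [one_sub_le_exp_neg u]
    · rw [abs_of_nonneg (h0 u (one_pos.trans hu)), rpow_zero]
      linarith [exp_pos (-u)]
  simpa using posDef_rpow_add_rpow_sub_add_rpow (ε := 1) h0
    (fun x y => by rw [neg_add, exp_add]; ring) hint hx hinj

lemma posDef_rpow_kernel_of_one_lt {K : ℝ} (hK1 : 1 < K) (hK2 : K < 2) {n : ℕ}
    {x : Fin n → ℝ} (hx : ∀ i, 0 < x i) (hinj : Function.Injective x) :
    (Matrix.of fun i j : Fin n => (x i + x j) ^ K - x i ^ K - x j ^ K).PosDef := by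
  have h0 : ∀ u : ℝ, 0 ≤ exp (-u) - 1 + u := fun u => by linarith [one_sub_le_exp_neg u]
  have hint : IntegrableOn (fun u : ℝ => (exp (-u) - 1 + u) * u ^ (-1 - K)) (Ioi 0) := by
    refine integrableOn_Ioi_mul_rpow_of_bounds (by fun_prop) hK1 hK2 (fun u hu => ?_)
      fun u hu => ?_
    · have h := abs_exp_sub_one_sub_id_le (x := -u) (by rw [abs_neg, abs_of_pos hu.1]; exact hu.2)
      rwa [sub_neg_eq_add, neg_sq, ← rpow_two] at h
    · have h : exp (-u) ≤ 1 := exp_le_one_iff.2 (neg_nonpos.2 (one_pos.trans hu).le)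
      rw [abs_of_nonneg (h0 u), rpow_one]
      linarith
  have h := posDef_rpow_add_rpow_sub_add_rpow (ε := -1) (fun u _ => h0 u)
    (fun x y => by rw [neg_add, exp_add]; ring) hint hx hinj
  convert h using 4
  ring

theorem XHK_covariance_matrix_posDef (H K : ℝ) (hH0 : 0 < H) (hH1 : H < 1)
    (hK : (0 < K ∧ K < 1) ∨ (1 < K ∧ K < 2)) (hHK0 : 0 < H * K) (hHK1 : H * K < 1)
    (n : ℕ) (hn : 1 ≤ n) (t : Fin n → ℝ)
    (hpos : ∀ i, 0 < t i) (hmono : StrictMono t) :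
    (Matrix.of fun i j : Fin n =>
      if K < 1 then
        (Real.Gamma (1 - K) / (K * (2 - K))) *
          ((t i) ^ (2 * H * K) + (t j) ^ (2 * H * K)
            - ((t i) ^ (2 * H) + (t j) ^ (2 * H)) ^ K)
      else
        (Real.Gamma (2 - K) / (K * (K - 1))) *
          (((t i) ^ (2 * H) + (t j) ^ (2 * H)) ^ K
            - (t i) ^ (2 * H * K) - (t j) ^ (2 * H * K))).PosDef := by
  have hx : ∀ i, 0 < t i ^ (2 * H) := fun i => rpow_pos_of_pos (hpos i) _
  have hinj : Function.Injective fun i => t i ^ (2 * H) := fun i j hij =>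
    hmono.injective ((rpow_left_inj (hpos i).le (hpos j).le (by positivity)).1 hij)
  have hpow : ∀ i, t i ^ (2 * H * K) = (t i ^ (2 * H)) ^ K := fun i => rpow_mul (hpos i).le _ _
  simp_rw [hpow]
  rcases hK with ⟨hK0, hK1⟩ | ⟨hK1, hK2⟩
  · simp only [if_pos hK1]
    have hc : 0 < Real.Gamma (1 - K) / (K * (2 - K)) :=
      div_pos (Gamma_pos_of_pos (by linarith)) (mul_pos hK0 (by linarith))
    exact (posDef_rpow_kernel_of_lt_one hK0 hK1 hx hinj).smul hc
  · simp only [if_neg hK1.not_gt]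
    have hc : 0 < Real.Gamma (2 - K) / (K * (K - 1)) :=
      div_pos (Gamma_pos_of_pos (by linarith)) (mul_pos (by linarith) (by linarith))
    exact (posDef_rpow_kernel_of_one_lt hK1 hK2 hx hinj).smul hc
end

section
/- Let 0 < H < 1 and define R(s,t) = ½(s^{2H} + t^{2H} − |t − s|^{2H}) (the covariance of fractional Brownian motion with Hurst parameter H). Then for any n ≥ 1 and any strictly increasing times 0 < t₁ < t₂ < ⋯ < t_n, the n×n matrix V with entries V_{ij} = R(t_i, t_j) is strictly positive definite. -/
open Matrix Real

open MeasureTheory Set in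
theorem setIntegral_Ioi_pos_of_continuousOn {f : ℝ → ℝ} (hc : ContinuousOn f (Ioi 0))
    (hi : IntegrableOn f (Ioi 0)) (h0 : ∀ u, 0 < u → 0 ≤ f u) (h : ∃ u, 0 < u ∧ f u ≠ 0) :
    0 < ∫ u in Ioi 0, f u := by
  have hae : 0 ≤ᵐ[volume.restrict (Ioi 0)] f := by
    filter_upwards [ae_restrict_mem measurableSet_Ioi] with u hu using h0 u hu
  refine lt_of_le_of_ne (integral_nonneg_of_ae hae) fun heq => ?_
  obtain ⟨u, hu, hne⟩ := h
  exact hne (Measure.eqOn_open_of_ae_eq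
    ((setIntegral_eq_zero_iff_of_nonneg_ae hae hi).1 heq.symm) isOpen_Ioi hc
    continuousOn_const hu)

theorem eq_zero_of_sum_mul_sin_eq_zero {ι : Type*} [Fintype ι] {t : ι → ℝ}
    (ht : Function.Injective t) (hpos : ∀ i, 0 < t i) {a : ι → ℝ}
    (h : ∀ u, 0 < u → ∑ i, a i * sin (u * t i) = 0) : a = 0 := by
  have hall : ∀ u : ℝ, ∑ i, a i * sin (u * t i) = 0 := by
    intro u
    rcases lt_trichotomy u 0 with hu | rfl | hu
    · simpa using h (-u) (neg_pos.2 hu)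
    · simp
    · exact h u hu
  let χ : ℝ → (Multiplicative ℝ →* ℂ) := fun s =>
    { toFun := fun u => Complex.exp (((u.toAdd * s : ℝ) : ℂ) * Complex.I)
      map_one' := by simp
      map_mul' := fun u v => by
        rw [← Complex.exp_add]
        simp [add_mul] }
  have hχ : Function.Injective χ := by
    intro r s hrs
    by_contra hne
    have hd : r - s ≠ 0 := sub_ne_zero.2 hne
    have h1 : Complex.exp (((π / (r - s) * r : ℝ) : ℂ) * Complex.I) =
        Complex.exp (((π / (r - s) * s : ℝ) : ℂ) * Complex.I) :=
      DFunLike.congr_fun hrs (Multiplicative.ofAdd (π / (r - s)))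
    have h2 : π / (r - s) * r = π + π / (r - s) * s := by field_simp; ring
    rw [h2, Complex.ofReal_add, add_mul, Complex.exp_add, Complex.exp_pi_mul_I, neg_one_mul,
      neg_eq_self] at h1
    exact Complex.exp_ne_zero _ h1
  have hinj : Function.Injective (Sum.elim t fun i => -t i) := by
    refine ht.sumElim (neg_injective.comp ht) fun i j hij => ?_
    have := hpos i
    have := hpos j
    linarith
  have hli := (linearIndependent_monoidHom (Multiplicative ℝ) ℂ).comp _ (hχ.comp hinj)
  have hz := Fintype.linearIndependent_iff.1 hli
    (Sum.elim (fun i => (a i : ℂ)) fun i => -(a i : ℂ)) (by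
      ext u
      have hu := congrArg (fun x : ℝ => (x : ℂ) * (2 * Complex.I)) (hall u.toAdd)
      simp only [Complex.ofReal_sum, Complex.ofReal_mul, Complex.ofReal_sin, Finset.sum_mul,
        Complex.ofReal_zero, zero_mul] at hu
      simp only [Fintype.sum_sum_type, Finset.sum_apply, Pi.smul_apply,
        Function.comp_apply, Sum.elim_inl, Sum.elim_inr, smul_eq_mul, Pi.zero_apply, χ,
        MonoidHom.coe_mk, OneHom.coe_mk]
      rw [← Finset.sum_add_distrib, ← hu]
      refine Finset.sum_congr rfl fun i _ => ?_
      rw [mul_neg, Complex.ofReal_neg, Complex.exp_mul_I, Complex.exp_mul_I, Complex.cos_neg,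
        Complex.sin_neg]
      push_cast
      ring)
  ext i
  exact Complex.ofReal_eq_zero.1 (hz (Sum.inl i))

open MeasureTheory Set in
theorem integrableOn_one_sub_cos_mul_rpow {H : ℝ} (hH0 : 0 < H) (hH1 : H < 1) (x : ℝ) :
    IntegrableOn (fun u : ℝ => (1 - cos (u * x)) * u ^ (-1 - 2 * H)) (Ioi 0) := by
  have hmeas : Measurable fun u : ℝ => (1 - cos (u * x)) * u ^ (-1 - 2 * H) := by fun_prop
  have hnn : ∀ u : ℝ, 0 ≤ 1 - cos (u * x) := fun u => sub_nonneg.2 (cos_le_one _)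
  rw [← Ioc_union_Ioi_eq_Ioi zero_le_one, integrableOn_union]
  constructor
  · have hb : IntegrableOn (fun u : ℝ => x ^ 2 / 2 * u ^ (1 - 2 * H)) (Ioc 0 1) :=
      ((intervalIntegrable_iff_integrableOn_Ioc_of_le zero_le_one).1
        (intervalIntegral.intervalIntegrable_rpow' (by linarith))).const_mul _
    refine hb.mono' hmeas.aestronglyMeasurable ?_
    filter_upwards [ae_restrict_mem measurableSet_Ioc] with u hu
    have hw : 0 ≤ u ^ (-1 - 2 * H) := rpow_nonneg hu.1.le _
    rw [norm_of_nonneg (mul_nonneg (hnn u) hw)]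
    have hsplit : u ^ (1 - 2 * H) = u ^ 2 * u ^ (-1 - 2 * H) := by
      rw [← rpow_natCast, ← rpow_add hu.1]
      congr 1
      push_cast
      ring
    calc (1 - cos (u * x)) * u ^ (-1 - 2 * H)
        ≤ ((u * x) ^ 2 / 2) * u ^ (-1 - 2 * H) := by
          gcongr
          linarith [one_sub_sq_div_two_le_cos (x := u * x)]
      _ = x ^ 2 / 2 * u ^ (1 - 2 * H) := by rw [hsplit]; ring
  · have hb : IntegrableOn (fun u : ℝ => 2 * u ^ (-1 - 2 * H)) (Ioi 1) :=
      (integrableOn_Ioi_rpow_of_lt (by linarith) one_pos).const_mul _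
    refine hb.mono' hmeas.aestronglyMeasurable ?_
    filter_upwards [ae_restrict_mem measurableSet_Ioi] with u hu
    have hw : 0 ≤ u ^ (-1 - 2 * H) := rpow_nonneg (one_pos.trans hu).le _
    rw [norm_of_nonneg (mul_nonneg (hnn u) hw)]
    gcongr
    linarith [neg_one_le_cos (u * x)]

open MeasureTheory Set in
theorem integral_one_sub_cos_mul_rpow {H : ℝ} (hH0 : 0 < H) (x : ℝ) :
    ∫ u in Ioi (0 : ℝ), (1 - cos (u * x)) * u ^ (-1 - 2 * H) =
      |x| ^ (2 * H) * ∫ u in Ioi (0 : ℝ), (1 - cos u) * u ^ (-1 - 2 * H) := by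
  rcases eq_or_ne x 0 with rfl | hx
  · simp [zero_rpow (by positivity : 2 * H ≠ 0)]
  have hb : 0 < |x| := abs_pos.2 hx
  have hscale := integral_comp_mul_left_Ioi
    (fun u : ℝ => (1 - cos u) * u ^ (-1 - 2 * H)) 0 hb
  rw [mul_zero, smul_eq_mul] at hscale
  have hpow : |x| ^ (2 * H) = |x| ^ (1 + 2 * H) * |x|⁻¹ := by
    rw [← rpow_neg_one, ← rpow_add hb]
    congr 1
    ring
  rw [hpow, mul_assoc, ← hscale, ← integral_const_mul]
  refine setIntegral_congr_fun measurableSet_Ioi fun u hu => ?_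
  have hcos : cos (|x| * u) = cos (u * x) := by
    rw [← cos_abs (u * x), abs_mul, abs_of_pos (mem_Ioi.1 hu), mul_comm]
  have hone : |x| ^ (1 + 2 * H) * |x| ^ (-1 - 2 * H) = 1 := by
    rw [← rpow_add hb]
    ring_nf
    exact rpow_zero _
  simp only [hcos, mul_rpow hb.le (mem_Ioi.1 hu).le]
  linear_combination (-(1 - cos (u * x)) * u ^ (-1 - 2 * H)) * hone

open MeasureTheory Set in
theorem integral_one_sub_cos_mul_rpow_pos {H : ℝ} (hH0 : 0 < H) (hH1 : H < 1) :
    0 < ∫ u in Ioi (0 : ℝ), (1 - cos u) * u ^ (-1 - 2 * H) := by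
  refine setIntegral_Ioi_pos_of_continuousOn ?_
    (by simpa using integrableOn_one_sub_cos_mul_rpow hH0 hH1 1)
    (fun u hu => mul_nonneg (sub_nonneg.2 (cos_le_one _)) (rpow_nonneg hu.le _))
    ⟨π, pi_pos, ?_⟩
  · exact ContinuousOn.mul (by fun_prop)
      (continuousOn_id.rpow_const fun u hu => Or.inl (ne_of_gt hu))
  · have := rpow_pos_of_pos pi_pos (-1 - 2 * H)
    rw [cos_pi]
    positivity

theorem sum_mul_one_sub_cos_eq_sq_add_sq {ι : Type*} [Fintype ι] (a t : ι → ℝ) (u : ℝ) :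
    ∑ i, ∑ j, a i * a j *
        ((1 - cos (u * t i)) + (1 - cos (u * t j)) - (1 - cos (u * (t j - t i)))) =
      (∑ i, a i * (1 - cos (u * t i))) ^ 2 + (∑ i, a i * sin (u * t i)) ^ 2 := by
  simp only [sq, Finset.sum_mul_sum, ← Finset.sum_add_distrib]
  refine Finset.sum_congr rfl fun i _ => Finset.sum_congr rfl fun j _ => ?_
  rw [mul_sub u, cos_sub]
  ring

open MeasureTheory Set in
theorem sum_mul_rpow_pos {ι : Type*} [Fintype ι] {H : ℝ} (hH0 : 0 < H) (hH1 : H < 1)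
    {t : ι → ℝ} (ht : Function.Injective t) (hpos : ∀ i, 0 < t i) {a : ι → ℝ} (ha : a ≠ 0) :
    0 < ∑ i, ∑ j, a i * a j *
      (t i ^ (2 * H) + t j ^ (2 * H) - |t j - t i| ^ (2 * H)) := by
  set K := ∫ u in Ioi (0 : ℝ), (1 - cos u) * u ^ (-1 - 2 * H)
  have hK : 0 < K := integral_one_sub_cos_mul_rpow_pos hH0 hH1
  let g : ℝ → ℝ → ℝ := fun x u => (1 - cos (u * x)) * u ^ (-1 - 2 * H)
  have hg : ∀ x, IntegrableOn (g x) (Ioi 0) := integrableOn_one_sub_cos_mul_rpow hH0 hH1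
  have hgK : ∀ x, ∫ u in Ioi (0 : ℝ), g x u = |x| ^ (2 * H) * K :=
    integral_one_sub_cos_mul_rpow hH0
  let F : ℝ → ℝ := fun u =>
    ∑ i, ∑ j, a i * a j * (g (t i) u + g (t j) u - g (t j - t i) u)
  have hterm : ∀ i j, IntegrableOn
      (fun u => a i * a j * (g (t i) u + g (t j) u - g (t j - t i) u)) (Ioi 0) := fun i j =>
    (((hg _).add (hg _)).sub (hg _)).const_mul _
  have hF : IntegrableOn F (Ioi 0) :=
    integrable_finsetSum _ fun i _ => integrable_finsetSum _ fun j _ => hterm i j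
  have hFK : ∫ u in Ioi (0 : ℝ), F u = (∑ i, ∑ j, a i * a j *
      (t i ^ (2 * H) + t j ^ (2 * H) - |t j - t i| ^ (2 * H))) * K := by
    rw [integral_finsetSum _ fun i _ => integrable_finsetSum _ fun j _ => hterm i j,
      Finset.sum_mul]
    refine Finset.sum_congr rfl fun i _ => ?_
    rw [integral_finsetSum _ fun j _ => hterm i j, Finset.sum_mul]
    refine Finset.sum_congr rfl fun j _ => ?_
    have hadd : IntegrableOn (fun u => g (t i) u + g (t j) u) (Ioi 0) := (hg _).add (hg _)
    rw [integral_const_mul, integral_sub hadd (hg _), integral_add (hg _) (hg _), hgK, hgK, hgK, abs_of_pos (hpos i), abs_of_pos (hpos j)]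
    ring
  have hFsq : ∀ u, F u = ((∑ i, a i * (1 - cos (u * t i))) ^ 2 +
      (∑ i, a i * sin (u * t i)) ^ 2) * u ^ (-1 - 2 * H) := by
    intro u
    rw [← sum_mul_one_sub_cos_eq_sq_add_sq]
    simp only [F, g, Finset.sum_mul]
    refine Finset.sum_congr rfl fun i _ => Finset.sum_congr rfl fun j _ => ?_
    ring
  refine pos_of_mul_pos_left (hFK ▸ ?_) hK.le
  refine setIntegral_Ioi_pos_of_continuousOn ?_ hF (fun u hu => ?_) ?_
  · rw [funext hFsq]
    exact ContinuousOn.mul (by fun_prop)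
      (continuousOn_id.rpow_const fun u hu => Or.inl (ne_of_gt hu))
  · rw [hFsq]
    exact mul_nonneg (by positivity) (rpow_nonneg hu.le _)
  · contrapose! ha
    refine eq_zero_of_sum_mul_sin_eq_zero ht hpos fun u hu => ?_
    have h := ha u hu
    rw [hFsq, mul_eq_zero, or_iff_left (rpow_pos_of_pos hu _).ne'] at h
    nlinarith [sq_nonneg (∑ i, a i * (1 - cos (u * t i))), sq_nonneg (∑ i, a i * sin (u * t i))]

theorem fbm_covariance_matrix_posDef (H : ℝ) (hH0 : 0 < H) (hH1 : H < 1)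
    (n : ℕ) (hn : 1 ≤ n) (t : Fin n → ℝ)
    (hpos : ∀ i, 0 < t i) (hmono : StrictMono t) :
    (Matrix.of fun i j : Fin n =>
      (1 / 2) * ((t i) ^ (2 * H) + (t j) ^ (2 * H) - |t j - t i| ^ (2 * H))).PosDef := by
  refine Matrix.PosDef.of_dotProduct_mulVec_pos ?_ fun a ha => ?_
  · ext i j
    simp only [conjTranspose_apply, of_apply, star_trivial, abs_sub_comm (t i)]
    ring
  · have h := sum_mul_rpow_pos hH0 hH1 hmono.injective hpos ha
    have heq : star a ⬝ᵥ ((Matrix.of fun i j : Fin n =>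
        (1 / 2) * ((t i) ^ (2 * H) + (t j) ^ (2 * H) - |t j - t i| ^ (2 * H))) *ᵥ a) =
        (1 / 2) * ∑ i, ∑ j, a i * a j *
          (t i ^ (2 * H) + t j ^ (2 * H) - |t j - t i| ^ (2 * H)) := by
      simp only [dotProduct, mulVec, of_apply, star_trivial, Pi.star_apply, Finset.mul_sum]
      refine Finset.sum_congr rfl fun i _ => Finset.sum_congr rfl fun j _ => ?_
      ring
    rw [heq]
    linarith
end

section
/- Let 0 < H < 1/2 and define R(s,t) = (s + t)^{2H} − (max(s,t))^{2H}. Then for any n ≥ 1 and any strictly increasing times 0 < t₁ < t₂ < ⋯ < t_n, the n×n matrix V with entries V_{ij} = R(t_i, t_j) is strictly positive definite. -/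
open Matrix Real

/-- The kernel `min` is strictly positive definite at increasing positive points. -/
theorem sum_mul_min_pos (n : ℕ) (τ c : Fin n → ℝ) (hτ : ∀ i, 0 < τ i) (hmono : StrictMono τ)
    (hc : c ≠ 0) : 0 < ∑ i, ∑ j, c i * c j * min (τ i) (τ j) := by
  induction n with
  | zero => exact absurd (Subsingleton.elim c 0) hc
  | succ n ih =>
    have hlt (i : Fin n) : τ 0 < τ i.succ := hmono (Fin.succ_pos i)
    have key : ∑ i, ∑ j, c i * c j * min (τ i) (τ j) = τ 0 * (∑ i, c i) ^ 2 +
        ∑ i : Fin n, ∑ j : Fin n,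
          c i.succ * c j.succ * min (τ i.succ - τ 0) (τ j.succ - τ 0) := by
      have hsq : τ 0 * (∑ i, c i) ^ 2 = ∑ i, ∑ j, c i * c j * τ 0 := by
        rw [sq, Finset.sum_mul_sum, Finset.mul_sum]
        refine Finset.sum_congr rfl fun i _ ↦ ?_
        rw [Finset.mul_sum]
        exact Finset.sum_congr rfl fun j _ ↦ by ring
      rw [hsq, ← sub_eq_iff_eq_add', ← Finset.sum_sub_distrib]
      simp only [← Finset.sum_sub_distrib, ← mul_sub]
      simp only [Fin.sum_univ_succ, min_self,
        min_eq_left (hlt _).le, min_eq_right (hlt _).le, sub_self, mul_zero,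
        Finset.sum_const_zero, zero_add, min_sub_sub_right]
    rw [key]
    by_cases h : (fun i : Fin n ↦ c i.succ) = 0
    · have hs (i : Fin n) : c i.succ = 0 := congrFun h i
      have h0 : c 0 ≠ 0 := fun h0 ↦ hc (funext fun i ↦ Fin.cases h0 hs i)
      simp only [hs, Fin.sum_univ_succ, zero_mul, Finset.sum_const_zero, add_zero]
      have := hτ 0
      positivity
    · have hpos := ih (fun i ↦ τ i.succ - τ 0) (fun i ↦ c i.succ)
        (fun i ↦ sub_pos.2 (hlt i))
        (fun i j hij ↦ sub_lt_sub_right (hmono (Fin.succ_lt_succ_iff.2 hij)) _) h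
      have := mul_nonneg (hτ 0).le (sq_nonneg (∑ i, c i))
      linarith

/-- The kernel `exp (-max s t * u) - exp (-(s + t) * u)` is strictly positive definite. -/
theorem sum_mul_exp_neg_max_sub_pos (n : ℕ) (t a : Fin n → ℝ) (ht : ∀ i, 0 < t i)
    (hmono : StrictMono t) (ha : a ≠ 0) {u : ℝ} (hu : 0 < u) :
    0 < ∑ i, ∑ j, a i * a j * (exp (-(max (t i) (t j) * u)) - exp (-((t i + t j) * u))) := by
  have hc : (fun i ↦ a i * exp (-(t i * u))) ≠ 0 := fun h ↦
    ha (funext fun i ↦ (mul_eq_zero.1 (congrFun h i)).resolve_right (exp_ne_zero _))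
  have hpos := sum_mul_min_pos n (fun i ↦ exp (t i * u) - 1) (fun i ↦ a i * exp (-(t i * u)))
    (fun i ↦ sub_pos.2 (one_lt_exp_iff.2 (mul_pos (ht i) hu)))
    (fun i j hij ↦ sub_lt_sub_right (exp_lt_exp.2 (mul_lt_mul_of_pos_right (hmono hij) hu)) _) hc
  have kernel (x y : ℝ) : exp (-(x * u)) * exp (-(y * u)) * (exp (x * u) - 1) =
      exp (-(y * u)) - exp (-((x + y) * u)) := by
    rw [mul_sub, mul_right_comm, ← exp_add, ← exp_add, ← exp_add]
    ring_nf
  refine hpos.trans_eq (Finset.sum_congr rfl fun i _ ↦ Finset.sum_congr rfl fun j _ ↦ ?_)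
  rcases le_total (t i) (t j) with h | h
  · rw [max_eq_right h, min_eq_left (by gcongr), ← kernel]
    ring
  · rw [max_eq_left h, min_eq_right (by gcongr), add_comm (t i), ← kernel]
    ring

open MeasureTheory Set in
theorem integrableOn_one_sub_exp_neg_mul_rpow {α : ℝ} (h0 : 0 < α) (h1 : α < 1) :
    IntegrableOn (fun u : ℝ ↦ (1 - exp (-u)) * u ^ (-1 - α)) (Ioi 0) := by
  have hcont : ContinuousOn (fun u : ℝ ↦ (1 - exp (-u)) * u ^ (-1 - α)) (Ioi 0) :=
    ContinuousOn.mul (by fun_prop)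
      (continuousOn_id.rpow_const fun x hx ↦ Or.inl (ne_of_gt hx))
  rw [← Ioc_union_Ioi_eq_Ioi zero_le_one, integrableOn_union]
  constructor
  · have hint : IntegrableOn (fun u : ℝ ↦ u ^ (-α)) (Ioc 0 1) :=
      (intervalIntegrable_iff_integrableOn_Ioc_of_le zero_le_one).1
        (intervalIntegral.intervalIntegrable_rpow' (by linarith))
    refine hint.mono'
      ((hcont.mono Ioc_subset_Ioi_self).aestronglyMeasurable measurableSet_Ioc) ?_
    filter_upwards [ae_restrict_mem measurableSet_Ioc] with u hu
    have he : exp (-u) ≤ 1 := exp_le_one_iff.2 (by linarith [hu.1])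
    rw [norm_of_nonneg (mul_nonneg (by linarith) (rpow_nonneg hu.1.le _))]
    calc (1 - exp (-u)) * u ^ (-1 - α) ≤ u * u ^ (-1 - α) :=
          mul_le_mul_of_nonneg_right (by linarith [add_one_le_exp (-u)]) (rpow_nonneg hu.1.le _)
      _ = u ^ (-α) := by rw [← rpow_one_add' hu.1.le (by linarith)]; ring_nf
  · have hint : IntegrableOn (fun u : ℝ ↦ u ^ (-1 - α)) (Ioi 1) :=
      integrableOn_Ioi_rpow_of_lt (by linarith) one_pos
    refine hint.mono' ((hcont.mono (Ioi_subset_Ioi zero_le_one)).aestronglyMeasurable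
      measurableSet_Ioi) ?_
    filter_upwards [ae_restrict_mem measurableSet_Ioi] with u hu
    have hu0 : 0 < u := one_pos.trans hu
    have he : exp (-u) ≤ 1 := exp_le_one_iff.2 (by linarith)
    rw [norm_of_nonneg (mul_nonneg (by linarith) (rpow_nonneg hu0.le _))]
    exact mul_le_of_le_one_left (rpow_nonneg hu0.le _) (by linarith [exp_pos (-u)])

/-- Rescaling the integrand of the integral representation of `x ^ α`. -/
theorem one_sub_exp_neg_mul_rpow_eq {α x u : ℝ} (hx : 0 < x) (hu : 0 < u) :
    (1 - exp (-(x * u))) * u ^ (-1 - α) =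
      x ^ (1 + α) * ((1 - exp (-(x * u))) * (x * u) ^ (-1 - α)) := by
  have h : x ^ (1 + α) * x ^ (-1 - α) = 1 := by
    rw [← rpow_add hx]
    simp
  rw [mul_rpow hx.le hu.le]
  linear_combination (-(1 - exp (-(x * u))) * u ^ (-1 - α)) * h

open MeasureTheory Set in
theorem integrableOn_one_sub_exp_neg_mul_mul_rpow {α x : ℝ} (h0 : 0 < α) (h1 : α < 1)
    (hx : 0 < x) :
    IntegrableOn (fun u : ℝ ↦ (1 - exp (-(x * u))) * u ^ (-1 - α)) (Ioi 0) := by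
  have h := (integrableOn_Ioi_comp_mul_left_iff
    (fun u : ℝ ↦ (1 - exp (-u)) * u ^ (-1 - α)) 0 hx).2
    (by simpa using integrableOn_one_sub_exp_neg_mul_rpow h0 h1)
  exact IntegrableOn.congr_fun (h.const_mul (x ^ (1 + α)))
    (fun u hu ↦ (one_sub_exp_neg_mul_rpow_eq hx hu).symm) measurableSet_Ioi

open MeasureTheory Set in
theorem integral_one_sub_exp_neg_mul_mul_rpow {α x : ℝ} (hx : 0 < x) :
    ∫ u in Ioi (0 : ℝ), (1 - exp (-(x * u))) * u ^ (-1 - α) =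
      x ^ α * ∫ u in Ioi (0 : ℝ), (1 - exp (-u)) * u ^ (-1 - α) := by
  rw [setIntegral_congr_fun measurableSet_Ioi
    (fun u hu ↦ one_sub_exp_neg_mul_rpow_eq (α := α) hx hu), integral_const_mul,
    integral_comp_mul_left_Ioi (fun u : ℝ ↦ (1 - exp (-u)) * u ^ (-1 - α)) 0 hx,
    mul_zero, smul_eq_mul, ← mul_assoc, rpow_add hx, rpow_one]
  field_simp

open MeasureTheory Set in
/-- The kernel `(s + t) ^ α - max s t ^ α` is strictly positive definite for `0 < α < 1`. -/
theorem sum_mul_add_rpow_sub_max_rpow_pos {α : ℝ} (h0 : 0 < α) (h1 : α < 1) (n : ℕ)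
    (t a : Fin n → ℝ) (ht : ∀ i, 0 < t i) (hmono : StrictMono t) (ha : a ≠ 0) :
    0 < ∑ i, ∑ j, a i * a j * ((t i + t j) ^ α - max (t i) (t j) ^ α) := by
  set C := ∫ u in Ioi (0 : ℝ), (1 - exp (-u)) * u ^ (-1 - α)
  have hC : 0 ≤ C := setIntegral_nonneg measurableSet_Ioi fun u hu ↦
    mul_nonneg (sub_nonneg.2 (exp_le_one_iff.2 (neg_nonpos.2 (le_of_lt hu))))
      (rpow_nonneg (le_of_lt hu) _)
  let k (i j : Fin n) (u : ℝ) : ℝ := a i * a j *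
    ((1 - exp (-((t i + t j) * u))) * u ^ (-1 - α) -
      (1 - exp (-(max (t i) (t j) * u))) * u ^ (-1 - α))
  have hsum (i j : Fin n) := integrableOn_one_sub_exp_neg_mul_mul_rpow h0 h1
    (add_pos (ht i) (ht j))
  have hmax (i j : Fin n) := integrableOn_one_sub_exp_neg_mul_mul_rpow h0 h1
    (lt_max_of_lt_left (b := t i) (c := t j) (ht i))
  have hk (i j : Fin n) : IntegrableOn (k i j) (Ioi 0) :=
    ((hsum i j).sub (hmax i j)).const_mul _
  have hrow (i : Fin n) : IntegrableOn (fun u ↦ ∑ j, k i j u) (Ioi 0) :=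
    integrable_finsetSum _ fun j _ ↦ hk i j
  have hint : IntegrableOn (fun u ↦ ∑ i, ∑ j, k i j u) (Ioi 0) :=
    integrable_finsetSum _ fun i _ ↦ hrow i
  have heq : ∫ u in Ioi (0 : ℝ), ∑ i, ∑ j, k i j u =
      C * ∑ i, ∑ j, a i * a j * ((t i + t j) ^ α - max (t i) (t j) ^ α) := by
    rw [integral_finsetSum _ fun i _ ↦ hrow i, Finset.mul_sum]
    refine Finset.sum_congr rfl fun i _ ↦ ?_
    rw [integral_finsetSum _ fun j _ ↦ hk i j, Finset.mul_sum]
    refine Finset.sum_congr rfl fun j _ ↦ ?_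
    rw [integral_const_mul, integral_sub (hsum i j) (hmax i j),
      integral_one_sub_exp_neg_mul_mul_rpow (add_pos (ht i) (ht j)),
      integral_one_sub_exp_neg_mul_mul_rpow (lt_max_of_lt_left (ht i))]
    ring
  have hpos : ∀ u ∈ Ioi (0 : ℝ), 0 < ∑ i, ∑ j, k i j u := by
    intro u hu
    refine (mul_pos (sum_mul_exp_neg_max_sub_pos n t a ht hmono ha hu)
      (rpow_pos_of_pos hu (-1 - α))).trans_eq ?_
    simp only [Finset.sum_mul]
    refine Finset.sum_congr rfl fun i _ ↦ Finset.sum_congr rfl fun j _ ↦ ?_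
    ring
  have hI : 0 < ∫ u in Ioi (0 : ℝ), ∑ i, ∑ j, k i j u := by
    rw [setIntegral_pos_iff_support_of_nonneg_ae
      ((ae_restrict_mem measurableSet_Ioi).mono fun u hu ↦ (hpos u hu).le) hint,
      inter_eq_right.2 fun u hu ↦ Function.mem_support.2 (hpos u hu).ne', Real.volume_Ioi]
    exact ENNReal.zero_lt_top
  exact pos_of_mul_pos_right (heq ▸ hI) hC

theorem N_covariance_matrix_posDef (H : ℝ) (hH0 : 0 < H) (hH1 : H < 1 / 2)
    (n : ℕ) (hn : 1 ≤ n) (t : Fin n → ℝ)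
    (hpos : ∀ i, 0 < t i) (hmono : StrictMono t) :
    (Matrix.of fun i j : Fin n =>
      (t i + t j) ^ (2 * H) - (max (t i) (t j)) ^ (2 * H)).PosDef := by
  refine PosDef.of_dotProduct_mulVec_pos ?_ fun a ha ↦ ?_
  · ext i j
    simp [add_comm (t i), max_comm (t i)]
  · refine (sum_mul_add_rpow_sub_max_rpow_pos (α := 2 * H) (by linarith) (by linarith)
      n t a hpos hmono ha).trans_eq ?_
    simp only [dotProduct, mulVec, Finset.mul_sum, of_apply, Pi.star_apply, star_trivial]
    refine Finset.sum_congr rfl fun i _ ↦ Finset.sum_congr rfl fun j _ ↦ ?_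
    ring
end

section
/- Let 0 < H < 1/2 and define R(s,t) = (max(s,t))^{2H} − |t − s|^{2H}. Then for any n ≥ 1 and any strictly increasing times 0 < t₁ < t₂ < ⋯ < t_n, the n×n matrix V with entries V_{ij} = R(t_i, t_j) is strictly positive definite. -/
open Matrix Real

/-- The kernel `min (u i) (u j) - c` is strictly positive definite along strictly increasing
sequences bounded below by `c`. -/
lemma sum_mul_min_sub_pos {n : ℕ} (u x : Fin n → ℝ) (c : ℝ) (hc : ∀ i, c < u i)
    (hu : StrictMono u) (hx : x ≠ 0) :
    0 < ∑ i, ∑ j, x i * x j * (min (u i) (u j) - c) := by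
  induction n generalizing c with
  | zero => exact absurd (Subsingleton.elim x 0) hx
  | succ n ih =>
    have hlt : ∀ i : Fin n, u 0 < u i.succ := fun i => hu (Fin.succ_pos i)
    have key : ∑ i, ∑ j, x i * x j * (min (u i) (u j) - c) =
        (u 0 - c) * (∑ i, x i) ^ 2 +
          ∑ i : Fin n, ∑ j : Fin n,
            x i.succ * x j.succ * (min (u i.succ) (u j.succ) - u 0) := by
      have h1 : ∑ i, ∑ j, x i * x j * (min (u i) (u j) - u 0) =
          ∑ i : Fin n, ∑ j : Fin n,
            x i.succ * x j.succ * (min (u i.succ) (u j.succ) - u 0) := by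
        simp [Fin.sum_univ_succ, min_eq_left (hlt _).le, min_eq_right (hlt _).le]
      rw [← h1, pow_two, Finset.sum_mul_sum, Finset.mul_sum, ← Finset.sum_add_distrib]
      refine Finset.sum_congr rfl fun i _ => ?_
      rw [Finset.mul_sum, ← Finset.sum_add_distrib]
      exact Finset.sum_congr rfl fun j _ => by ring
    rw [key]
    have h0 : 0 < u 0 - c := sub_pos.2 (hc 0)
    by_cases hy : (fun i : Fin n => x i.succ) = 0
    · have hy' : ∀ i : Fin n, x i.succ = 0 := congrFun hy
      have hx0 : x 0 ≠ 0 := fun h => hx (funext fun i => Fin.cases h hy' i)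
      simp only [Fin.sum_univ_succ, hy', Finset.sum_const_zero, add_zero, zero_mul]
      positivity
    · exact add_pos_of_nonneg_of_pos (by positivity)
        (ih (fun i => u i.succ) _ (u 0) hlt (fun _ _ h => hu (Fin.succ_lt_succ_iff.2 h)) hy)

lemma max_rpow_mul_min_div_max_pow {s t : ℝ} (hs : 0 < s) (ht : 0 < t) (a : ℝ) (m : ℕ)
    (hm : a < 2 * m) :
    max s t ^ a * (min s t / max s t) ^ m =
      s ^ (a - m) * t ^ (a - m) * min (s ^ (2 * m - a)) (t ^ (2 * m - a)) := by
  wlog h : s ≤ t generalizing s t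
  · rw [max_comm, min_comm, this ht hs (le_of_not_ge h), min_comm (t ^ _)]
    ring
  rw [max_eq_right h, min_eq_left h, min_eq_left (rpow_le_rpow hs.le h (by linarith)), div_pow,
    mul_right_comm, ← rpow_add hs, rpow_sub ht, rpow_natCast,
    show a - m + (2 * m - a) = (m : ℝ) by ring, rpow_natCast]
  ring

lemma sum_mul_max_rpow_mul_min_div_max_pow_pos {n : ℕ} (t x : Fin n → ℝ) (hpos : ∀ i, 0 < t i)
    (hmono : StrictMono t) (hx : x ≠ 0) (a : ℝ) (m : ℕ) (hm : a < 2 * m) :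
    0 < ∑ i, ∑ j, x i * x j *
      (max (t i) (t j) ^ a * (min (t i) (t j) / max (t i) (t j)) ^ m) := by
  have h := sum_mul_min_sub_pos (fun i => t i ^ (2 * m - a)) (fun i => x i * t i ^ (a - m)) 0
    (fun i => rpow_pos_of_pos (hpos i) _)
    (fun i j hij => rpow_lt_rpow (hpos i).le (hmono hij) (by linarith))
    (fun h => hx (funext fun i =>
      (mul_eq_zero.1 (congrFun h i)).resolve_right (rpow_pos_of_pos (hpos i) _).ne'))
  refine h.trans_eq (Finset.sum_congr rfl fun i _ => Finset.sum_congr rfl fun j _ => ?_)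
  rw [max_rpow_mul_min_div_max_pow (hpos i) (hpos j) a m hm]
  ring

lemma neg_one_pow_mul_choose_succ_nonneg {a : ℝ} (ha0 : 0 ≤ a) (ha1 : a ≤ 1) (k : ℕ) :
    0 ≤ (-1) ^ k * Ring.choose a (k + 1) := by
  induction k with
  | zero => simpa using ha0
  | succ k ih =>
    have h := Ring.choose_smul_choose a (Nat.le_succ (k + 1))
    simp only [Nat.succ_eq_add_one, Nat.choose_succ_self_right, Nat.add_sub_cancel_left,
      Ring.choose_one_right, nsmul_eq_mul] at h
    push_cast at h
    have h2 : ((k : ℝ) + 1 + 1) * ((-1) ^ (k + 1) * Ring.choose a (k + 1 + 1)) =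
        ((-1) ^ k * Ring.choose a (k + 1)) * (k + 1 - a) := by
      rw [pow_succ]
      linear_combination -(-1) ^ k * h
    have h3 : (0 : ℝ) ≤ k + 1 - a := by
      have : (0 : ℝ) ≤ k := k.cast_nonneg
      linarith
    exact nonneg_of_mul_nonneg_right (h2 ▸ mul_nonneg ih h3) (by positivity)

lemma hasSum_one_sub_one_sub_rpow (a : ℝ) {y : ℝ} (hy : |y| < 1) :
    HasSum (fun k : ℕ => (-1) ^ k * Ring.choose a (k + 1) * y ^ (k + 1))
      (1 - (1 - y) ^ a) := by
  have h := (one_add_rpow_hasFPowerSeriesOnBall_zero (a := a)).hasSum (y := -y)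
    (by simpa [Metric.mem_eball, edist_dist, Real.dist_eq] using hy)
  simp only [binomialSeries_apply, zero_add, List.ofFn_const, List.prod_replicate,
    smul_eq_mul] at h
  rw [← hasSum_nat_add_iff' 1] at h
  simp only [Finset.sum_range_one, Ring.choose_zero_right, pow_zero, mul_one] at h
  rw [← neg_sub, sub_eq_add_neg 1 y]
  refine h.neg.congr_fun fun k => ?_
  rw [neg_pow y, pow_succ (-1)]
  ring

lemma le_sum_mul_max_rpow_mul_one_sub {n : ℕ} (t x : Fin n → ℝ) (hpos : ∀ i, 0 < t i)
    (hmono : StrictMono t) {a : ℝ} (ha0 : 0 < a) (ha1 : a ≤ 1) {ρ : ℝ}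
    (hρ0 : 0 < ρ) (hρ1 : ρ < 1) :
    a * ρ * ∑ i, ∑ j, x i * x j *
        (max (t i) (t j) ^ a * (min (t i) (t j) / max (t i) (t j)) ^ 1) ≤
      ∑ i, ∑ j, x i * x j *
        (max (t i) (t j) ^ a * (1 - (1 - ρ * (min (t i) (t j) / max (t i) (t j))) ^ a)) := by
  by_cases hx : x = 0
  · simp [hx]
  have hs : HasSum (fun k : ℕ => (-1) ^ k * Ring.choose a (k + 1) * ρ ^ (k + 1) *
      ∑ i, ∑ j, x i * x j *
        (max (t i) (t j) ^ a * (min (t i) (t j) / max (t i) (t j)) ^ (k + 1)))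
      (∑ i, ∑ j, x i * x j *
        (max (t i) (t j) ^ a * (1 - (1 - ρ * (min (t i) (t j) / max (t i) (t j))) ^ a))) := by
    simp only [Finset.mul_sum]
    refine hasSum_sum fun i _ => hasSum_sum fun j _ => ?_
    have hmin : 0 < min (t i) (t j) := lt_min (hpos i) (hpos j)
    have hmax : 0 < max (t i) (t j) := lt_max_of_lt_left (hpos i)
    have hr1 : min (t i) (t j) / max (t i) (t j) ≤ 1 := (div_le_one hmax).2 min_le_max
    have hr0 : 0 < min (t i) (t j) / max (t i) (t j) := div_pos hmin hmax
    have hy : |ρ * (min (t i) (t j) / max (t i) (t j))| < 1 := by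
      rw [abs_of_pos (mul_pos hρ0 hr0)]
      nlinarith
    have h := ((hasSum_one_sub_one_sub_rpow a hy).mul_left (max (t i) (t j) ^ a)).mul_left
      (x i * x j)
    refine h.congr_fun fun k => ?_
    rw [mul_pow]
    ring
  have h := hs.summable.sum_le_tsum {0} fun k _ => mul_nonneg
    (mul_nonneg (neg_one_pow_mul_choose_succ_nonneg ha0.le ha1 k) (by positivity))
    (sum_mul_max_rpow_mul_min_div_max_pow_pos t x hpos hmono hx a (k + 1) (by
      push_cast
      have : (0 : ℝ) ≤ k := k.cast_nonneg
      linarith)).le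
  rw [hs.tsum_eq] at h
  simpa using h

lemma max_rpow_mul_one_sub {s t : ℝ} (hs : 0 < s) (a : ℝ) :
    max s t ^ a * (1 - (1 - min s t / max s t) ^ a) = max s t ^ a - |t - s| ^ a := by
  have hmax : 0 < max s t := lt_max_of_lt_left hs
  have h : |t - s| = max s t * (1 - min s t / max s t) := by
    rw [← max_sub_min_eq_abs']
    field_simp
    rw [max_comm, min_comm]
  rw [h, mul_rpow hmax.le (sub_nonneg.2 ((div_le_one hmax).2 min_le_max))]
  ring

theorem Z_covariance_matrix_posDef (H : ℝ) (hH0 : 0 < H) (hH1 : H < 1 / 2)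
    (n : ℕ) (hn : 1 ≤ n) (t : Fin n → ℝ)
    (hpos : ∀ i, 0 < t i) (hmono : StrictMono t) :
    (Matrix.of fun i j : Fin n =>
      (max (t i) (t j)) ^ (2 * H) - |t j - t i| ^ (2 * H)).PosDef := by
  refine PosDef.of_dotProduct_mulVec_pos ?_ fun x hx => ?_
  · ext i j
    simp [max_comm, abs_sub_comm]
  have ha0 : 0 < 2 * H := by linarith
  have hq := sum_mul_max_rpow_mul_min_div_max_pow_pos t x hpos hmono hx (2 * H) 1
    (by push_cast; linarith)
  have hlim : ∀ ρ ∈ Set.Ioo (0 : ℝ) 1, _ := fun ρ hρ =>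
    le_sum_mul_max_rpow_mul_one_sub t x hpos hmono ha0 (by linarith) hρ.1 hρ.2
  have hle := ContinuousWithinAt.closure_le (s := Set.Ioo (0 : ℝ) 1) (x := 1)
    (by simp [closure_Ioo]) (Continuous.continuousWithinAt (by fun_prop))
    (Continuous.continuousWithinAt (by
      refine continuous_finsetSum _ fun i _ => continuous_finsetSum _ fun j _ => ?_
      refine continuous_const.mul (continuous_const.mul (continuous_const.sub ?_))
      exact Continuous.rpow_const (by fun_prop) fun _ => Or.inr ha0.le)) hlim
  refine (mul_pos (mul_pos ha0 one_pos) hq).trans_le (hle.trans_eq ?_)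
  simp only [one_mul, dotProduct, mulVec, Finset.mul_sum, of_apply, star_trivial]
  refine Finset.sum_congr rfl fun i _ => Finset.sum_congr rfl fun j _ => ?_
  rw [max_rpow_mul_one_sub (hpos i)]
  ring
end

section
/- Define R(t,s) = (s^{2H} + t^{2H})^K − ½[(t + s)^{2HK} + |t − s|^{2HK}], and assume either (i) 0 < H < 1, K ∈ (1,2) and HK ∈ (0,1), or (ii) 0 < H < 1/2 and K ∈ (0,1). Then for any n ≥ 1 and any strictly increasing times 0 < t₁ < t₂ < ⋯ < t_n, the n×n matrix V with entries V_{ij} = R(t_i, t_j) is strictly positive definite. -/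
open Matrix Real

section IntegralValues

open MeasureTheory Set

/-- `g` is integrable on `(0, ∞)` with integral `v`. -/
def HasIntegralIoi (g : ℝ → ℝ) (v : ℝ) : Prop :=
  IntegrableOn g (Ioi 0) ∧ ∫ x in Ioi 0, g x = v

namespace HasIntegralIoi

variable {f g : ℝ → ℝ} {v w : ℝ}

lemma add (hf : HasIntegralIoi f v) (hg : HasIntegralIoi g w) :
    HasIntegralIoi (fun x => f x + g x) (v + w) :=
  ⟨hf.1.add hg.1, by rw [integral_add hf.1 hg.1, hf.2, hg.2]⟩

lemma sub (hf : HasIntegralIoi f v) (hg : HasIntegralIoi g w) :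
    HasIntegralIoi (fun x => f x - g x) (v - w) :=
  ⟨hf.1.sub hg.1, by rw [integral_sub hf.1 hg.1, hf.2, hg.2]⟩

lemma const_mul (a : ℝ) (hf : HasIntegralIoi f v) :
    HasIntegralIoi (fun x => a * f x) (a * v) :=
  ⟨Integrable.const_mul hf.1 a, by rw [integral_const_mul, hf.2]⟩

lemma sum {ι : Type*} {s : Finset ι} {f : ι → ℝ → ℝ} {v : ι → ℝ}
    (h : ∀ i ∈ s, HasIntegralIoi (f i) (v i)) :
    HasIntegralIoi (fun x => ∑ i ∈ s, f i x) (∑ i ∈ s, v i) :=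
  ⟨integrable_finsetSum s fun i hi => (h i hi).1, by
    rw [integral_finsetSum s fun i hi => (h i hi).1]
    exact Finset.sum_congr rfl fun i hi => (h i hi).2⟩

lemma congr (hf : HasIntegralIoi f v) (hfg : ∀ x, 0 < x → f x = g x) (hvw : v = w) :
    HasIntegralIoi g w :=
  ⟨hf.1.congr_fun hfg measurableSet_Ioi, by
    rw [← hvw, ← hf.2]
    exact setIntegral_congr_fun measurableSet_Ioi fun x hx => (hfg x hx).symm⟩

lemma nonneg (hf : HasIntegralIoi f v) (h : ∀ x, 0 < x → 0 ≤ f x) : 0 ≤ v :=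
  hf.2 ▸ setIntegral_nonneg measurableSet_Ioi h

lemma pos (hf : HasIntegralIoi f v) (h : ∀ x, 0 < x → 0 ≤ f x) (hc : ContinuousOn f (Ioi 0))
    (hpos : ∃ x, 0 < x ∧ 0 < f x) : 0 < v := by
  refine (hf.nonneg h).lt_of_ne fun hv => ?_
  have h0 : f =ᵐ[volume.restrict (Ioi 0)] 0 :=
    (setIntegral_eq_zero_iff_of_nonneg_ae (ae_restrict_of_forall_mem measurableSet_Ioi h)
      hf.1).mp (hf.2.trans hv.symm)
  obtain ⟨x, hx, hfx⟩ := hpos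
  exact hfx.ne' (Measure.eqOn_open_of_ae_eq h0 isOpen_Ioi hc continuousOn_const hx)

end HasIntegralIoi

lemma continuousOn_mul_rpow_Ioi {f : ℝ → ℝ} (hf : Continuous f) (r : ℝ) :
    ContinuousOn (fun x => f x * x ^ r) (Ioi 0) :=
  hf.continuousOn.mul (continuousOn_id.rpow_const fun _ hx => Or.inl (ne_of_gt hx))

/-- Scaling turns `∫ f (y x) x ^ (-(1 + α))` over `(0, ∞)` into a multiple of `y ^ α`. -/
lemma exists_hasIntegralIoi_rpow {f : ℝ → ℝ} {α p q A : ℝ} (hf : Continuous f)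
    (hf0 : f 0 = 0) (hnonneg : ∀ x, 0 < x → 0 ≤ f x) (hpos : ∃ x, 0 < x ∧ 0 < f x)
    (hα : 0 < α) (hp : α < p) (hq : q < α) (hfp : ∀ x, 0 < x → f x ≤ A * x ^ p)
    (hfq : ∀ x, 0 < x → f x ≤ A * x ^ q) :
    ∃ c, 0 < c ∧ ∀ y, 0 ≤ y →
      HasIntegralIoi (fun x => f (y * x) * x ^ (-(1 + α))) (c * y ^ α) := by
  have hcont := continuousOn_mul_rpow_Ioi hf (-(1 + α))
  have hmeas := hcont.aestronglyMeasurable (μ := volume) measurableSet_Ioi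
  have hbound : ∀ r, (∀ x, 0 < x → f x ≤ A * x ^ r) → ∀ x, 0 < x →
      ‖f x * x ^ (-(1 + α))‖ ≤ A * x ^ (r - (1 + α)) := fun r hr x hx => by
    rw [Real.norm_of_nonneg (mul_nonneg (hnonneg x hx) (rpow_nonneg hx.le _)), sub_eq_add_neg,
      rpow_add hx, ← mul_assoc]
    exact mul_le_mul_of_nonneg_right (hr x hx) (rpow_nonneg hx.le _)
  have hint : IntegrableOn (fun x => f x * x ^ (-(1 + α))) (Ioi 0) := by
    rw [← Ioc_union_Ioi_eq_Ioi zero_le_one]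
    refine IntegrableOn.union ?_ ?_
    · have h := (intervalIntegral.intervalIntegrable_rpow' (a := 0) (b := 1)
        (r := p - (1 + α)) (by linarith)).1.const_mul A
      refine Integrable.mono' h (hmeas.mono_set Ioc_subset_Ioi_self) ?_
      exact ae_restrict_of_forall_mem measurableSet_Ioc fun x hx => hbound p hfp x hx.1
    · have h := (integrableOn_Ioi_rpow_of_lt (a := q - (1 + α)) (by linarith)
        zero_lt_one).const_mul A
      refine Integrable.mono' h (hmeas.mono_set (Ioi_subset_Ioi zero_le_one)) ?_
      exact ae_restrict_of_forall_mem measurableSet_Ioi fun x hx =>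
        hbound q hfq x (zero_lt_one.trans hx)
  refine ⟨∫ x in Ioi 0, f x * x ^ (-(1 + α)), ?_, fun y hy => ?_⟩
  · refine HasIntegralIoi.pos ⟨hint, rfl⟩
      (fun x hx => mul_nonneg (hnonneg x hx) (rpow_nonneg hx.le _)) hcont ?_
    obtain ⟨x, hx, hfx⟩ := hpos
    exact ⟨x, hx, mul_pos hfx (rpow_pos_of_pos hx _)⟩
  rcases hy.eq_or_lt with rfl | hy
  · simp [HasIntegralIoi, hf0, zero_rpow hα.ne']
  have hscale : HasIntegralIoi (fun x => f (y * x) * (y * x) ^ (-(1 + α)))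
      (y⁻¹ * ∫ x in Ioi 0, f x * x ^ (-(1 + α))) := by
    refine ⟨?_, ?_⟩
    · have := (integrableOn_Ioi_comp_mul_left_iff
        (fun x => f x * x ^ (-(1 + α))) 0 hy).mpr (by simpa using hint)
      exact this
    · have := integral_comp_mul_left_Ioi (fun x => f x * x ^ (-(1 + α))) 0 hy
      simpa using this
  refine (hscale.const_mul (y ^ (1 + α))).congr (fun x hx => ?_) ?_
  · rw [mul_rpow hy.le hx.le, rpow_neg hy.le]
    field_simp
  · rw [rpow_add hy, rpow_one]
    field_simp

lemma exists_hasIntegralIoi_one_sub_cos {α : ℝ} (h0 : 0 < α) (h2 : α < 2) :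
    ∃ c, 0 < c ∧ ∀ y, 0 ≤ y →
      HasIntegralIoi (fun x => (1 - cos (y * x)) * x ^ (-(1 + α))) (c * y ^ α) := by
  refine exists_hasIntegralIoi_rpow (f := fun x => 1 - cos x) (p := 2) (q := 0) (A := 2)
    (by fun_prop) (by simp) (fun x _ => by linarith [cos_le_one x]) ⟨π, pi_pos, by simp⟩
    h0 h2 h0 (fun x _ => ?_) (fun x _ => ?_)
  · have := one_sub_sq_div_two_le_cos (x := x)
    rw [rpow_two]
    nlinarith [sq_nonneg x]
  · rw [rpow_zero]
    linarith [neg_one_le_cos x]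

lemma exists_hasIntegralIoi_one_sub_exp_neg {α : ℝ} (h0 : 0 < α) (h1 : α < 1) :
    ∃ c, 0 < c ∧ ∀ y, 0 ≤ y →
      HasIntegralIoi (fun x => (1 - exp (-(y * x))) * x ^ (-(1 + α))) (c * y ^ α) := by
  refine exists_hasIntegralIoi_rpow (f := fun x => 1 - exp (-x)) (p := 1) (q := 0) (A := 1)
    (by fun_prop) (by simp) (fun x hx => ?_) ⟨1, one_pos, ?_⟩
    h0 h1 h0 (fun x _ => ?_) (fun x _ => ?_)
  · simpa using hx.le
  · simp
  · rw [rpow_one]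
    linarith [add_one_le_exp (-x)]
  · rw [rpow_zero]
    linarith [exp_pos (-x)]

lemma exists_hasIntegralIoi_exp_neg_sub_one_add {α : ℝ} (h1 : 1 < α) (h2 : α < 2) :
    ∃ c, 0 < c ∧ ∀ y, 0 ≤ y →
      HasIntegralIoi (fun x => (exp (-(y * x)) - 1 + y * x) * x ^ (-(1 + α)))
        (c * y ^ α) := by
  refine exists_hasIntegralIoi_rpow (f := fun x => exp (-x) - 1 + x) (p := 2) (q := 1) (A := 1)
    (by fun_prop) (by simp) (fun x _ => by linarith [add_one_le_exp (-x)])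
    ⟨1, one_pos, by simp [exp_pos]⟩ (by linarith) h2 h1 (fun x hx => ?_) (fun x hx => ?_)
  · rw [rpow_two, one_mul]
    rcases le_total x 1 with h | h
    · have := abs_exp_sub_one_sub_id_le (x := -x) (by rwa [abs_neg, abs_of_pos hx])
      have := (abs_le.mp this).2
      nlinarith
    · have : exp (-x) ≤ 1 := exp_le_one_iff.mpr (by linarith)
      nlinarith
  · rw [rpow_one]
    have : exp (-x) ≤ 1 := exp_le_one_iff.mpr (by linarith)
    linarith

end IntegralValues

section QuadraticForms

variable {ι : Type*} [Fintype ι]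

lemma star_dotProduct_mulVec_eq_sum (M : Matrix ι ι ℝ) (a : ι → ℝ) :
    star a ⬝ᵥ (M *ᵥ a) = ∑ i, ∑ j, a i * a j * M i j := by
  simp only [dotProduct, mulVec, Finset.mul_sum, star_trivial]
  exact Finset.sum_congr rfl fun i _ => Finset.sum_congr rfl fun j _ => by ring

lemma hasIntegralIoi_quadraticForm {F : ℝ → Matrix ι ι ℝ} {M : Matrix ι ι ℝ} {c : ℝ}
    (hF : ∀ i j, HasIntegralIoi (fun x => F x i j) (c * M i j)) (a : ι → ℝ) :
    HasIntegralIoi (fun x => star a ⬝ᵥ (F x *ᵥ a)) (c * (star a ⬝ᵥ (M *ᵥ a))) := by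
  have h := HasIntegralIoi.sum (s := Finset.univ) fun i _ =>
    HasIntegralIoi.sum (s := Finset.univ) fun j _ => (hF i j).const_mul (a i * a j)
  refine h.congr (fun x _ => (star_dotProduct_mulVec_eq_sum _ _).symm) ?_
  simp only [star_dotProduct_mulVec_eq_sum, Finset.mul_sum]
  exact Finset.sum_congr rfl fun i _ => Finset.sum_congr rfl fun j _ => by ring

lemma isHermitian_of_hasIntegralIoi {ι : Type*} {F : ℝ → Matrix ι ι ℝ} {M : Matrix ι ι ℝ}
    {c : ℝ} (hc : 0 < c) (hF : ∀ i j, HasIntegralIoi (fun x => F x i j) (c * M i j))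
    (hpsd : ∀ x, 0 < x → (F x).PosSemidef) : M.IsHermitian := by
  ext i j
  have h := (hF j i).congr (fun x hx => (hpsd x hx).isHermitian.apply i j) rfl
  exact mul_left_cancel₀ hc.ne' (h.2.symm.trans (hF i j).2)

lemma posSemidef_of_hasIntegralIoi {F : ℝ → Matrix ι ι ℝ} {M : Matrix ι ι ℝ} {c : ℝ}
    (hc : 0 < c) (hF : ∀ i j, HasIntegralIoi (fun x => F x i j) (c * M i j))
    (hpsd : ∀ x, 0 < x → (F x).PosSemidef) : M.PosSemidef :=
  .of_dotProduct_mulVec_nonneg (isHermitian_of_hasIntegralIoi hc hF hpsd) fun a =>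
    (mul_nonneg_iff_of_pos_left hc).mp <| (hasIntegralIoi_quadraticForm hF a).nonneg
      fun x hx => (hpsd x hx).dotProduct_mulVec_nonneg a

lemma posDef_of_hasIntegralIoi {F : ℝ → Matrix ι ι ℝ} {M : Matrix ι ι ℝ} {c : ℝ}
    (hc : 0 < c) (hF : ∀ i j, HasIntegralIoi (fun x => F x i j) (c * M i j))
    (hpsd : ∀ x, 0 < x → (F x).PosSemidef)
    (hcont : ∀ i j, ContinuousOn (fun x => F x i j) (Set.Ioi 0))
    (hpos : ∀ a : ι → ℝ, a ≠ 0 → ∃ x, 0 < x ∧ 0 < star a ⬝ᵥ (F x *ᵥ a)) : M.PosDef := by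
  refine .of_dotProduct_mulVec_pos (isHermitian_of_hasIntegralIoi hc hF hpsd) fun a ha =>
    (mul_pos_iff_of_pos_left hc).mp <| (hasIntegralIoi_quadraticForm hF a).pos
      (fun x hx => (hpsd x hx).dotProduct_mulVec_nonneg a) ?_ (hpos a ha)
  simp only [star_dotProduct_mulVec_eq_sum]
  exact continuousOn_finsetSum _ fun i _ => continuousOn_finsetSum _ fun j _ =>
    continuousOn_const.mul (hcont i j)

lemma posSemidef_rankOne (v : ι → ℝ) {w : ℝ} (hw : 0 ≤ w) :
    (Matrix.of fun i j => v i * v j * w).PosSemidef := by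
  have h := (posSemidef_vecMulVec_self_star v).smul hw
  convert h using 1
  ext i j
  simp [vecMulVec_apply, mul_comm]

lemma star_dotProduct_rankOne_mulVec (v a : ι → ℝ) (w : ℝ) :
    star a ⬝ᵥ ((Matrix.of fun i j => v i * v j * w) *ᵥ a) = (∑ i, a i * v i) ^ 2 * w := by
  rw [star_dotProduct_mulVec_eq_sum, sq, Finset.sum_mul_sum, Finset.sum_mul]
  refine Finset.sum_congr rfl fun i _ => ?_
  rw [Finset.sum_mul]
  exact Finset.sum_congr rfl fun j _ => by rw [of_apply]; ring

lemma Matrix.PosSemidef.map_pow {G : Matrix ι ι ℝ} (hG : G.PosSemidef) (k : ℕ) :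
    (G.map (· ^ k)).PosSemidef := by
  induction k with
  | zero =>
    convert posSemidef_rankOne (fun _ : ι => (1 : ℝ)) zero_le_one using 1
    ext i j
    simp
  | succ k ih =>
    have h : G.map (· ^ (k + 1)) = G.map (· ^ k) ⊙ G := by
      ext i j
      simp [pow_succ]
    exact h ▸ ih.hadamard hG

/-- Termwise application of the power series of `exp x - 1 - x` preserves positivity. -/
lemma Matrix.PosSemidef.map_exp_sub_one_sub_id {G : Matrix ι ι ℝ} (hG : G.PosSemidef) :
    (G.map fun y => exp y - 1 - y).PosSemidef := by
  refine .of_dotProduct_mulVec_nonneg ?_ fun a => ?_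
  · ext i j
    simp [← hG.isHermitian.apply i j]
  have hexp (y : ℝ) :
      HasSum (fun k : ℕ => y ^ (k + 2) / ((k + 2).factorial : ℝ)) (exp y - 1 - y) := by
    have h := (hasSum_nat_add_iff' 2).mpr (NormedSpace.expSeries_div_hasSum_exp y)
    rw [← congrFun exp_eq_exp_ℝ y] at h
    simpa [Finset.sum_range_succ, sub_sub] using h
  have hsum := hasSum_sum (s := Finset.univ) fun i _ =>
    hasSum_sum (s := Finset.univ) fun j _ => (hexp (G i j)).mul_left (a i * a j)
  rw [star_dotProduct_mulVec_eq_sum]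
  refine hsum.nonneg fun k => ?_
  have h := (hG.map_pow (k + 2)).dotProduct_mulVec_nonneg a
  rw [star_dotProduct_mulVec_eq_sum] at h
  convert div_nonneg h (Nat.cast_nonneg (k + 2).factorial) using 1
  simp [Finset.sum_div, mul_div_assoc]

lemma Matrix.PosSemidef.map_exp_sub_one {G : Matrix ι ι ℝ} (hG : G.PosSemidef) :
    (G.map fun y => exp y - 1).PosSemidef := by
  convert hG.map_exp_sub_one_sub_id.add hG using 1
  ext i j
  simp

lemma Matrix.PosDef.map_exp_sub_one {G : Matrix ι ι ℝ} (hG : G.PosDef) :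
    (G.map fun y => exp y - 1).PosDef := by
  convert PosDef.posSemidef_add hG.posSemidef.map_exp_sub_one_sub_id hG using 1
  ext i j
  simp

end QuadraticForms

section PowerKernels

variable {ι : Type*} [Fintype ι]

lemma posSemidef_add_rpow_sub_rpow_sub_rpow {K : ℝ} (h1 : 1 < K) (h2 : K < 2) {u : ι → ℝ}
    (hu : ∀ i, 0 ≤ u i) :
    (Matrix.of fun i j => (u i + u j) ^ K - u i ^ K - u j ^ K).PosSemidef := by
  obtain ⟨c, hc, h⟩ := exists_hasIntegralIoi_exp_neg_sub_one_add h1 h2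
  refine posSemidef_of_hasIntegralIoi hc (F := fun x => Matrix.of fun i j =>
      (1 - exp (-(u i * x))) * (1 - exp (-(u j * x))) * x ^ (-(1 + K)))
    (fun i j => ?_) fun x hx => posSemidef_rankOne _ (rpow_nonneg hx.le _)
  refine (((h _ (add_nonneg (hu i) (hu j))).sub (h _ (hu i))).sub (h _ (hu j))).congr
    (fun x _ => ?_) (by simp only [of_apply]; ring)
  simp only [of_apply, add_mul, neg_add, exp_add]
  ring

lemma posSemidef_rpow_add_rpow_sub_add_rpow {β : ℝ} (h0 : 0 < β) (h1 : β < 1) {t : ι → ℝ}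
    (ht : ∀ i, 0 ≤ t i) :
    (Matrix.of fun i j => t i ^ β + t j ^ β - (t i + t j) ^ β).PosSemidef := by
  obtain ⟨c, hc, h⟩ := exists_hasIntegralIoi_one_sub_exp_neg h0 h1
  refine posSemidef_of_hasIntegralIoi hc (F := fun x => Matrix.of fun i j =>
      (1 - exp (-(t i * x))) * (1 - exp (-(t j * x))) * x ^ (-(1 + β)))
    (fun i j => ?_) fun x hx => posSemidef_rankOne _ (rpow_nonneg hx.le _)
  refine (((h _ (ht i)).add (h _ (ht j))).sub (h _ (add_nonneg (ht i) (ht j)))).congr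
    (fun x _ => ?_) (by simp only [of_apply]; ring)
  simp only [of_apply, add_mul, neg_add, exp_add]
  ring

lemma cos_abs_mul (y x : ℝ) : cos (|y| * x) = cos (y * x) := by
  rcases abs_choice y with h | h <;> simp [h]

lemma posSemidef_add_rpow_sub_abs_sub_rpow {α : ℝ} (h0 : 0 < α) (h2 : α < 2) {t : ι → ℝ}
    (ht : ∀ i, 0 ≤ t i) :
    (Matrix.of fun i j => (t i + t j) ^ α - |t i - t j| ^ α).PosSemidef := by
  obtain ⟨c, hc, h⟩ := exists_hasIntegralIoi_one_sub_cos h0 h2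
  refine posSemidef_of_hasIntegralIoi hc (F := fun x => Matrix.of fun i j =>
      sin (t i * x) * sin (t j * x) * (2 * x ^ (-(1 + α))))
    (fun i j => ?_)
    fun x hx => posSemidef_rankOne _ (mul_nonneg zero_le_two (rpow_nonneg hx.le _))
  refine ((h _ (add_nonneg (ht i) (ht j))).sub (h _ (abs_nonneg (t i - t j)))).congr
    (fun x _ => ?_) (by simp only [of_apply]; ring)
  simp only [of_apply, cos_abs_mul, add_mul, sub_mul, cos_add, cos_sub]
  ring

/-- Differentiating a vanishing cosine polynomial twice multiplies its coefficients by the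
squared frequencies. -/
lemma sum_mul_sq_mul_cos_eq_zero {b t : ι → ℝ} {C : ℝ}
    (h : ∀ x, ∑ i, b i * cos (t i * x) = C) (x : ℝ) :
    ∑ i, b i * t i ^ 2 * cos (t i * x) = 0 := by
  have hderiv : ∀ x, ∑ i, b i * t i * sin (t i * x) = 0 := fun x => by
    have h' : HasDerivAt (fun x => ∑ i, b i * cos (t i * x))
        (∑ i, b i * (-sin (t i * x) * (t i * 1))) x :=
      HasDerivAt.fun_sum fun i _ =>
        (((hasDerivAt_id x).const_mul (t i)).cos).const_mul (b i)
    rw [funext h] at h'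
    have h0 := h'.unique (hasDerivAt_const x C)
    rw [← neg_eq_zero, ← h0, ← Finset.sum_neg_distrib]
    exact Finset.sum_congr rfl fun i _ => by ring
  have h' : HasDerivAt (fun x => ∑ i, b i * t i * sin (t i * x))
      (∑ i, b i * t i * (cos (t i * x) * (t i * 1))) x :=
    HasDerivAt.fun_sum fun i _ =>
      (((hasDerivAt_id x).const_mul (t i)).sin).const_mul (b i * t i)
  rw [funext hderiv] at h'
  have h0 := h'.unique (hasDerivAt_const x 0)
  rw [← h0]
  exact Finset.sum_congr rfl fun i _ => by ring

lemma eq_zero_of_sum_mul_one_sub_cos_eq_zero {n : ℕ} {a t : Fin n → ℝ} (ht : ∀ i, 0 < t i)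
    (hinj : Function.Injective t)
    (h : ∀ x, 0 < x → ∑ i, a i * (1 - cos (t i * x)) = 0) : a = 0 := by
  have hall : ∀ x, ∑ i, a i * cos (t i * x) = ∑ i, a i := fun x => by
    rw [eq_comm, ← sub_eq_zero, ← Finset.sum_sub_distrib]
    have habs : ∑ i, a i * (1 - cos (t i * |x|)) = 0 := by
      rcases eq_or_ne x 0 with rfl | hx
      · simp
      · exact h _ (abs_pos.mpr hx)
    rw [← habs]
    refine Finset.sum_congr rfl fun i _ => ?_
    rw [mul_comm _ |x|, cos_abs_mul, mul_comm x]
    ring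
  have hpow : ∀ k : ℕ, ∀ x, ∑ i, a i * t i ^ 2 * (t i ^ 2) ^ k * cos (t i * x) = 0 := by
    intro k
    induction k with
    | zero => simpa using sum_mul_sq_mul_cos_eq_zero hall
    | succ k ih =>
      simpa [pow_succ _ k, mul_assoc] using sum_mul_sq_mul_cos_eq_zero ih
  have hsq : Function.Injective fun i => t i ^ 2 := fun i j hij =>
    hinj ((pow_left_inj₀ (ht i).le (ht j).le two_ne_zero).mp hij)
  have hzero : (fun i => a i * t i ^ 2) = 0 :=
    eq_zero_of_forall_pow_sum_mul_pow_eq_zero hsq fun k => by simpa using hpow k 0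
  ext i
  simpa [(ht i).ne'] using congrFun hzero i

/-- Strict positivity of the sub-fractional Brownian covariance. -/
lemma posDef_subfractional {α : ℝ} (h0 : 0 < α) (h2 : α < 2) {n : ℕ} {t : Fin n → ℝ}
    (ht : ∀ i, 0 < t i) (hinj : Function.Injective t) :
    (Matrix.of fun i j =>
      t i ^ α + t j ^ α - (1 / 2) * ((t i + t j) ^ α + |t i - t j| ^ α)).PosDef := by
  obtain ⟨c, hc, h⟩ := exists_hasIntegralIoi_one_sub_cos h0 h2
  refine posDef_of_hasIntegralIoi hc (F := fun x => Matrix.of fun i j =>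
      (1 - cos (t i * x)) * (1 - cos (t j * x)) * x ^ (-(1 + α)))
    (fun i j => ?_) (fun x hx => posSemidef_rankOne _ (rpow_nonneg hx.le _))
    (fun i j => continuousOn_mul_rpow_Ioi (by fun_prop) _) fun a ha => ?_
  · refine (((h _ (ht i).le).add (h _ (ht j).le)).sub
      (((h _ (add_pos (ht i) (ht j)).le).add (h _ (abs_nonneg (t i - t j)))).const_mul
        (1 / 2))).congr (fun x _ => ?_) (by simp only [of_apply]; ring)
    simp only [of_apply, cos_abs_mul, add_mul, sub_mul, cos_add, cos_sub]
    ring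
  · contrapose! ha
    refine eq_zero_of_sum_mul_one_sub_cos_eq_zero ht hinj fun x hx => ?_
    have hle := ha x hx
    rw [star_dotProduct_rankOne_mulVec] at hle
    exact pow_eq_zero_iff two_ne_zero |>.mp <| le_antisymm
      (nonpos_of_mul_nonpos_left hle (rpow_pos_of_pos hx _)) (sq_nonneg _)

/-- Strict positivity of the fractional Brownian covariance. -/
lemma posDef_fractional {α : ℝ} (h0 : 0 < α) (h2 : α < 2) {n : ℕ} {t : Fin n → ℝ}
    (ht : ∀ i, 0 < t i) (hinj : Function.Injective t) :
    (Matrix.of fun i j => t i ^ α + t j ^ α - |t i - t j| ^ α).PosDef := by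
  convert (posDef_subfractional h0 h2 ht hinj).add_posSemidef
    ((posSemidef_add_rpow_sub_abs_sub_rpow h0 h2 fun i => (ht i).le).smul
      (show (0 : ℝ) ≤ 1 / 2 by norm_num)) using 1
  ext i j
  simp only [of_apply, Matrix.add_apply, Matrix.smul_apply, smul_eq_mul]
  ring

/-- The integrand that represents `(u i + u j) ^ K - D i j ^ K` for `0 < K < 1`, where
`D i j = u i + u j - G i j`. -/
noncomputable def subordinationKernel (K : ℝ) (u : ι → ℝ) (G : Matrix ι ι ℝ) (x : ℝ) :
    Matrix ι ι ℝ :=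
  Matrix.of fun i j =>
    exp (-(u i * x)) * (exp (x * G i j) - 1) * exp (-(u j * x)) * x ^ (-(1 + K))

lemma exists_hasIntegralIoi_subordinationKernel {ι : Type*} {K : ℝ} (h0 : 0 < K)
    (h1 : K < 1) {u : ι → ℝ} {D : Matrix ι ι ℝ} (hu : ∀ i, 0 ≤ u i) (hD : ∀ i j, 0 ≤ D i j) :
    ∃ c, 0 < c ∧ ∀ i j, HasIntegralIoi
      (fun x => subordinationKernel K u (Matrix.of fun i j => u i + u j - D i j) x i j)
      (c * (Matrix.of fun i j => (u i + u j) ^ K - D i j ^ K) i j) := by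
  obtain ⟨c, hc, h⟩ := exists_hasIntegralIoi_one_sub_exp_neg h0 h1
  refine ⟨c, hc, fun i j => ((h _ (add_nonneg (hu i) (hu j))).sub (h _ (hD i j))).congr
    (fun x _ => ?_) (by simp only [of_apply]; ring)⟩
  have hexp : exp (-(u i * x)) * exp (x * (u i + u j - D i j)) * exp (-(u j * x)) =
      exp (-(D i j * x)) := by
    rw [← exp_add, ← exp_add]
    ring_nf
  have hexp' : exp (-((u i + u j) * x)) = exp (-(u i * x)) * exp (-(u j * x)) := by
    rw [← exp_add]
    ring_nf
  simp only [subordinationKernel, of_apply, hexp', ← hexp]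
  ring

lemma subordinationKernel_eq [DecidableEq ι] (K : ℝ) (u : ι → ℝ) (G : Matrix ι ι ℝ) (x : ℝ) :
    subordinationKernel K u G x = x ^ (-(1 + K)) • (diagonal (fun i => exp (-(u i * x))) *
      (x • G).map (fun y => exp y - 1) * (diagonal fun i => exp (-(u i * x)))ᴴ) := by
  ext i j
  simp [subordinationKernel, mul_comm]

lemma posSemidef_subordinationKernel (K : ℝ) (u : ι → ℝ) {G : Matrix ι ι ℝ}
    (hG : G.PosSemidef) {x : ℝ} (hx : 0 < x) : (subordinationKernel K u G x).PosSemidef := by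
  classical
  rw [subordinationKernel_eq]
  exact ((hG.smul hx.le).map_exp_sub_one.mul_mul_conjTranspose_same _).smul
    (rpow_nonneg hx.le _)

lemma posDef_subordinationKernel (K : ℝ) (u : ι → ℝ) {G : Matrix ι ι ℝ}
    (hG : G.PosDef) {x : ℝ} (hx : 0 < x) : (subordinationKernel K u G x).PosDef := by
  classical
  rw [subordinationKernel_eq]
  refine ((hG.smul hx).map_exp_sub_one.mul_mul_conjTranspose_same ?_).smul
    (rpow_pos_of_pos hx _)
  intro a b hab
  ext i
  simpa [vecMul_diagonal, (exp_pos _).ne'] using congrFun hab i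

lemma posSemidef_add_rpow_sub_rpow {K : ℝ} (h0 : 0 < K) (h1 : K < 1) {u : ι → ℝ}
    {D : Matrix ι ι ℝ} (hu : ∀ i, 0 ≤ u i) (hD : ∀ i j, 0 ≤ D i j)
    (hG : (Matrix.of fun i j => u i + u j - D i j).PosSemidef) :
    (Matrix.of fun i j => (u i + u j) ^ K - D i j ^ K).PosSemidef := by
  obtain ⟨c, hc, h⟩ := exists_hasIntegralIoi_subordinationKernel h0 h1 hu hD
  exact posSemidef_of_hasIntegralIoi hc h fun x hx => posSemidef_subordinationKernel K u hG hx

lemma posDef_add_rpow_sub_rpow {K : ℝ} (h0 : 0 < K) (h1 : K < 1) {u : ι → ℝ}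
    {D : Matrix ι ι ℝ} (hu : ∀ i, 0 ≤ u i) (hD : ∀ i j, 0 ≤ D i j)
    (hG : (Matrix.of fun i j => u i + u j - D i j).PosDef) :
    (Matrix.of fun i j => (u i + u j) ^ K - D i j ^ K).PosDef := by
  obtain ⟨c, hc, h⟩ := exists_hasIntegralIoi_subordinationKernel h0 h1 hu hD
  refine posDef_of_hasIntegralIoi hc h
    (fun x hx => posSemidef_subordinationKernel K u hG.posSemidef hx)
    (fun i j => continuousOn_mul_rpow_Ioi (by fun_prop) _) fun a ha =>
    ⟨1, one_pos, (posDef_subordinationKernel K u hG one_pos).dotProduct_mulVec_pos ha⟩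

end PowerKernels

theorem subbifbm_covariance_matrix_posDef (H K : ℝ)
    (hHK : (0 < H ∧ H < 1 ∧ 1 < K ∧ K < 2 ∧ 0 < H * K ∧ H * K < 1) ∨
           (0 < H ∧ H < 1 / 2 ∧ 0 < K ∧ K < 1))
    (n : ℕ) (hn : 1 ≤ n) (t : Fin n → ℝ)
    (hpos : ∀ i, 0 < t i) (hmono : StrictMono t) :
    (Matrix.of fun i j : Fin n =>
      ((t i) ^ (2 * H) + (t j) ^ (2 * H)) ^ K
        - (1 / 2) * ((t i + t j) ^ (2 * H * K) + |t i - t j| ^ (2 * H * K))).PosDef := by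
  have ht : ∀ i, 0 ≤ t i := fun i => (hpos i).le
  have hinj := hmono.injective
  rcases hHK with ⟨hH, -, hK1, hK2, h0, h1⟩ | ⟨hH0, hH1, hK0, hK1⟩
  · convert (posDef_subfractional (α := 2 * H * K) (by linarith) (by linarith) hpos
      hinj).add_posSemidef (posSemidef_add_rpow_sub_rpow_sub_rpow hK1 hK2
        (u := fun i => t i ^ (2 * H)) fun i => rpow_nonneg (ht i) _) using 1
    ext i j
    simp only [of_apply, Matrix.add_apply, ← rpow_mul (ht _)]
    ring
  · have hu : ∀ i, 0 ≤ t i ^ (2 * H) := fun i => rpow_nonneg (ht i) _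
    have hdiff := posDef_add_rpow_sub_rpow hK0 hK1 hu
      (D := Matrix.of fun i j => |t i - t j| ^ (2 * H))
      (fun i j => rpow_nonneg (abs_nonneg _) _)
      (posDef_fractional (by linarith) (by linarith) hpos hinj)
    have hsum := posSemidef_add_rpow_sub_rpow hK0 hK1 hu
      (D := Matrix.of fun i j => (t i + t j) ^ (2 * H))
      (fun i j => rpow_nonneg (add_nonneg (ht i) (ht j)) _)
      (posSemidef_rpow_add_rpow_sub_add_rpow (by linarith) (by linarith) ht)
    have hhalf : (0 : ℝ) < 1 / 2 := by norm_num
    convert (hdiff.smul hhalf).add_posSemidef (hsum.smul hhalf.le) using 1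
    ext i j
    simp only [of_apply, Matrix.add_apply, Matrix.smul_apply, smul_eq_mul,
      ← rpow_mul (abs_nonneg (t i - t j)), ← rpow_mul (add_nonneg (ht i) (ht j))]
    ring
end

section
/- Let R : [0,∞) × [0,∞) → ℝ be a symmetric covariance function such that (Hypothesis 1) there exist constants c > 0 and β < 2 with R(t,t) ≤ c t^{β} for all t ≥ 0, and (Hypothesis 2) for all strictly increasing times the matrix (R(t_i,t_j)) is strictly positive definite. Let 0 < t₁ < t₂ < ⋯ be a strictly increasing sequence of times satisfying c₁ n^{α} ≤ t_n ≤ c₂ n^{α} for fixed constants α > 0 and 0 < c₁ ≤ c₂. Let μ ∈ ℝ, σ > 0, and let (X_{t})_{t≥0} be a stochastic process on a probability space such that for every n the random vector (X_{t₁}, …, X_{t_n}) has the multivariate Gaussian distribution with mean μ·(t₁,…,t_n) and covariance matrix σ² V_n, where V_n = (R(t_i,t_j))_{1≤i,j≤n}. Define for each n: μ̂_n = (tᵀ V_n^{−1} X)/(tᵀ V_n^{−1} t) and σ̂²_n = (1/n)·[(Xᵀ V_n^{−1} X)(tᵀ V_n^{−1} t) − (tᵀ V_n^{−1} X)²]/(tᵀ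 V_n^{−1} t), where t = (t₁,…,t_n) and X = (X_{t₁},…,X_{t_n}). Then μ̂_n → μ almost surely and σ̂²_n → σ² almost surely as n → ∞. -/
open Matrix Real MeasureTheory Filter

/-- The multivariate Gaussian measure on `Fin n → ℝ` with mean `m` and (strictly positive
definite) covariance matrix `S`, given by its density with respect to Lebesgue measure. -/
noncomputable def mvGaussianOf (n : ℕ) (m : Fin n → ℝ)
    (S : Matrix (Fin n) (Fin n) ℝ) : Measure (Fin n → ℝ) :=
  volume.withDensity fun x =>
    ENNReal.ofReal ((Real.sqrt ((2 * Real.pi) ^ n * S.det))⁻¹ *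
      Real.exp (-(1 / 2) * ((x - m) ⬝ᵥ (S⁻¹ *ᵥ (x - m)))))

/-- The covariance matrix `(R(t_i, t_j))_{1 ≤ i,j ≤ n}` of the observations. -/
noncomputable def covMat (R : ℝ → ℝ → ℝ) (t : ℕ → ℝ) (n : ℕ) :
    Matrix (Fin n) (Fin n) ℝ :=
  Matrix.of fun i j => R (t ((i : ℕ) + 1)) (t ((j : ℕ) + 1))

/-- The observation-time vector `(t_1, …, t_n)`. -/
noncomputable def tVec (t : ℕ → ℝ) (n : ℕ) : Fin n → ℝ := fun i => t ((i : ℕ) + 1)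

/-- The maximum likelihood estimator of the drift parameter `μ`. -/
noncomputable def muHat (n : ℕ) (V : Matrix (Fin n) (Fin n) ℝ) (t X : Fin n → ℝ) : ℝ :=
  (t ⬝ᵥ (V⁻¹ *ᵥ X)) / (t ⬝ᵥ (V⁻¹ *ᵥ t))

/-- The maximum likelihood estimator of the variance parameter `σ²`. -/
noncomputable def sigmaHatSq (n : ℕ) (V : Matrix (Fin n) (Fin n) ℝ)
    (t X : Fin n → ℝ) : ℝ :=
  (1 / (n : ℝ)) *
    (((X ⬝ᵥ (V⁻¹ *ᵥ X)) * (t ⬝ᵥ (V⁻¹ *ᵥ t)) - (t ⬝ᵥ (V⁻¹ *ᵥ X)) ^ 2) /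
      (t ⬝ᵥ (V⁻¹ *ᵥ t)))

/-! ### Quadratic forms -/

theorem dotProduct_mulVec_comm_of_isSymm {n : ℕ} {A : Matrix (Fin n) (Fin n) ℝ} (hA : A.IsSymm)
    (x y : Fin n → ℝ) : x ⬝ᵥ (A *ᵥ y) = y ⬝ᵥ (A *ᵥ x) := by
  rw [dotProduct_mulVec, ← mulVec_transpose, hA.eq, dotProduct_comm]

theorem quadForm_sub_smul {n : ℕ} {A : Matrix (Fin n) (Fin n) ℝ} (hA : A.IsSymm) (s : ℝ)
    (x y : Fin n → ℝ) :
    (y - s • x) ⬝ᵥ (A *ᵥ (y - s • x)) =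
      y ⬝ᵥ (A *ᵥ y) - 2 * s * (x ⬝ᵥ (A *ᵥ y)) + s ^ 2 * (x ⬝ᵥ (A *ᵥ x)) := by
  simp only [mulVec_sub, mulVec_smul, sub_dotProduct, dotProduct_sub, smul_dotProduct,
    dotProduct_smul, smul_eq_mul]
  rw [dotProduct_mulVec_comm_of_isSymm hA y x]
  ring

theorem quadForm_smul {n : ℕ} (A : Matrix (Fin n) (Fin n) ℝ) (s : ℝ) (y : Fin n → ℝ) :
    (s • y) ⬝ᵥ (A *ᵥ (s • y)) = s ^ 2 * (y ⬝ᵥ (A *ᵥ y)) := by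
  simp only [mulVec_smul, smul_dotProduct, dotProduct_smul, smul_eq_mul]
  ring

theorem isSymm_inv_of_posDef {n : ℕ} {V : Matrix (Fin n) (Fin n) ℝ} (hV : V.PosDef) :
    V⁻¹.IsSymm := by
  have h := hV.inv.isHermitian
  rwa [Matrix.IsHermitian, conjTranspose_eq_transpose_of_trivial] at h

/-- Cauchy–Schwarz for the form `V⁻¹`, tested against a column of `V`. -/
theorem sq_div_diag_le_quadForm_inv {n : ℕ} {V : Matrix (Fin n) (Fin n) ℝ} (hV : V.PosDef)
    (x : Fin n → ℝ) (i : Fin n) : x i ^ 2 / V i i ≤ x ⬝ᵥ (V⁻¹ *ᵥ x) := by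
  have hd : 0 < V i i := hV.diag_pos
  have hinv : V⁻¹ *ᵥ (V *ᵥ Pi.single i 1) = Pi.single i 1 := by
    rw [mulVec_mulVec, nonsing_inv_mul _ ((isUnit_iff_isUnit_det _).1 hV.isUnit), one_mulVec]
  have hnonneg := hV.inv.posSemidef.dotProduct_mulVec_nonneg
    (x - (x i / V i i) • (V *ᵥ Pi.single i 1))
  rw [star_trivial, quadForm_sub_smul (isSymm_inv_of_posDef hV),
    dotProduct_mulVec_comm_of_isSymm (isSymm_inv_of_posDef hV) (V *ᵥ Pi.single i 1) x, hinv] at hnonneg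
  have h1 : x ⬝ᵥ Pi.single i (1 : ℝ) = x i := by simp
  have h2 : (V *ᵥ Pi.single i 1) ⬝ᵥ Pi.single i (1 : ℝ) = V i i := by simp
  rw [h1, h2] at hnonneg
  have h3 : 2 * (x i / V i i) * x i = 2 * (x i ^ 2 / V i i) := by ring
  have h4 : (x i / V i i) ^ 2 * V i i = x i ^ 2 / V i i := by field_simp
  linarith

/-! ### Exponential moments of the Gaussian law -/

theorem measurable_quadForm {n : ℕ} (A : Matrix (Fin n) (Fin n) ℝ) :
    Measurable fun y : Fin n → ℝ => y ⬝ᵥ (A *ᵥ y) := by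
  unfold dotProduct mulVec dotProduct
  fun_prop

theorem measurable_dotProduct_mulVec {n : ℕ} (A : Matrix (Fin n) (Fin n) ℝ) (b : Fin n → ℝ) :
    Measurable fun y : Fin n → ℝ => b ⬝ᵥ (A *ᵥ y) := by
  unfold dotProduct mulVec dotProduct
  fun_prop

theorem lintegral_mvGaussianOf {n : ℕ} (m : Fin n → ℝ) (S : Matrix (Fin n) (Fin n) ℝ)
    {g : (Fin n → ℝ) → ENNReal} (hg : Measurable g) :
    ∫⁻ x, g (x - m) ∂mvGaussianOf n m S =
      ∫⁻ y, ENNReal.ofReal ((√((2 * π) ^ n * S.det))⁻¹ *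
        Real.exp (-(1 / 2) * (y ⬝ᵥ (S⁻¹ *ᵥ y)))) * g y := by
  have hq := measurable_quadForm S⁻¹
  have hd : Measurable fun y : Fin n → ℝ => ENNReal.ofReal ((√((2 * π) ^ n * S.det))⁻¹ *
      Real.exp (-(1 / 2) * (y ⬝ᵥ (S⁻¹ *ᵥ y)))) := by fun_prop
  have hsub : Measurable fun x : Fin n → ℝ => x - m := measurable_id.sub_const m
  unfold mvGaussianOf
  refine (lintegral_withDensity_eq_lintegral_mul _ (hd.comp hsub) (hg.comp hsub)).trans ?_
  exact lintegral_sub_right_eq_self (fun y => ENNReal.ofReal ((√((2 * π) ^ n * S.det))⁻¹ *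
    Real.exp (-(1 / 2) * (y ⬝ᵥ (S⁻¹ *ᵥ y)))) * g y) m

theorem lintegral_density_of_isProbabilityMeasure {n : ℕ} (m : Fin n → ℝ)
    (S : Matrix (Fin n) (Fin n) ℝ) [IsProbabilityMeasure (mvGaussianOf n m S)] :
    ∫⁻ y, ENNReal.ofReal ((√((2 * π) ^ n * S.det))⁻¹ *
        Real.exp (-(1 / 2) * (y ⬝ᵥ (S⁻¹ *ᵥ y)))) = 1 := by
  have h := lintegral_mvGaussianOf m S (g := fun _ => 1) measurable_const
  simpa using h.symm

/-- The Laplace transform of a linear functional, by completing the square. -/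
theorem lintegral_exp_linear_mvGaussianOf {n : ℕ} (m : Fin n → ℝ) {S : Matrix (Fin n) (Fin n) ℝ}
    (hS : S⁻¹.IsSymm) [IsProbabilityMeasure (mvGaussianOf n m S)] (b : Fin n → ℝ) (s : ℝ) :
    ∫⁻ x, ENNReal.ofReal (Real.exp (s * (b ⬝ᵥ (S⁻¹ *ᵥ (x - m))))) ∂mvGaussianOf n m S =
      ENNReal.ofReal (Real.exp (s ^ 2 * (b ⬝ᵥ (S⁻¹ *ᵥ b)) / 2)) := by
  have hl := measurable_dotProduct_mulVec S⁻¹ b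
  have hq := measurable_quadForm S⁻¹
  rw [lintegral_mvGaussianOf m S
    (g := fun y => ENNReal.ofReal (Real.exp (s * (b ⬝ᵥ (S⁻¹ *ᵥ y))))) (by fun_prop)]
  have hpt : ∀ y : Fin n → ℝ,
      ENNReal.ofReal ((√((2 * π) ^ n * S.det))⁻¹ * Real.exp (-(1 / 2) * (y ⬝ᵥ (S⁻¹ *ᵥ y)))) *
        ENNReal.ofReal (Real.exp (s * (b ⬝ᵥ (S⁻¹ *ᵥ y)))) =
      ENNReal.ofReal (Real.exp (s ^ 2 * (b ⬝ᵥ (S⁻¹ *ᵥ b)) / 2)) *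
        ENNReal.ofReal ((√((2 * π) ^ n * S.det))⁻¹ *
          Real.exp (-(1 / 2) * ((y - s • b) ⬝ᵥ (S⁻¹ *ᵥ (y - s • b))))) := by
    intro y
    rw [← ENNReal.ofReal_mul (by positivity), ← ENNReal.ofReal_mul (by positivity),
      quadForm_sub_smul hS, mul_assoc, ← Real.exp_add, mul_left_comm, ← Real.exp_add]
    congr 3
    ring
  simp_rw [hpt]
  rw [lintegral_const_mul' _ _ ENNReal.ofReal_ne_top,
    lintegral_sub_right_eq_self (fun y => ENNReal.ofReal ((√((2 * π) ^ n * S.det))⁻¹ *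
      Real.exp (-(1 / 2) * (y ⬝ᵥ (S⁻¹ *ᵥ y))))) (s • b),
    lintegral_density_of_isProbabilityMeasure m S, mul_one]

theorem lintegral_comp_inv_smul {n : ℕ} {l : ℝ} (hl : 0 < l) {f : (Fin n → ℝ) → ENNReal}
    (hf : Measurable f) :
    ∫⁻ y, f (l⁻¹ • y) = ENNReal.ofReal (l ^ n) * ∫⁻ y, f y := by
  rw [← lintegral_map hf (measurable_const_smul l⁻¹),
    Measure.map_addHaar_smul _ (inv_ne_zero hl.ne'), lintegral_smul_measure]
  simp [abs_of_pos hl]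

/-- The Laplace transform of the normalized quadratic form, by scaling. -/
theorem lintegral_exp_quadForm_mvGaussianOf {n : ℕ} (m : Fin n → ℝ)
    (S : Matrix (Fin n) (Fin n) ℝ) [IsProbabilityMeasure (mvGaussianOf n m S)]
    {l : ℝ} (hl : 0 < l) :
    ∫⁻ x, ENNReal.ofReal (Real.exp ((1 - (l⁻¹) ^ 2) / 2 * ((x - m) ⬝ᵥ (S⁻¹ *ᵥ (x - m)))))
        ∂mvGaussianOf n m S = ENNReal.ofReal (l ^ n) := by
  have hq := measurable_quadForm S⁻¹
  rw [lintegral_mvGaussianOf m S (g := fun y =>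
    ENNReal.ofReal (Real.exp ((1 - (l⁻¹) ^ 2) / 2 * (y ⬝ᵥ (S⁻¹ *ᵥ y))))) (by fun_prop)]
  have hpt : ∀ y : Fin n → ℝ,
      ENNReal.ofReal ((√((2 * π) ^ n * S.det))⁻¹ * Real.exp (-(1 / 2) * (y ⬝ᵥ (S⁻¹ *ᵥ y)))) *
        ENNReal.ofReal (Real.exp ((1 - (l⁻¹) ^ 2) / 2 * (y ⬝ᵥ (S⁻¹ *ᵥ y)))) =
      ENNReal.ofReal ((√((2 * π) ^ n * S.det))⁻¹ *
          Real.exp (-(1 / 2) * ((l⁻¹ • y) ⬝ᵥ (S⁻¹ *ᵥ (l⁻¹ • y))))) := by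
    intro y
    rw [← ENNReal.ofReal_mul (by positivity), quadForm_smul, mul_assoc, ← Real.exp_add]
    congr 3
    ring
  simp_rw [hpt]
  rw [lintegral_comp_inv_smul hl (f := fun y => ENNReal.ofReal ((√((2 * π) ^ n * S.det))⁻¹ *
    Real.exp (-(1 / 2) * (y ⬝ᵥ (S⁻¹ *ᵥ y))))) (by fun_prop),
    lintegral_density_of_isProbabilityMeasure m S, mul_one]

theorem mvGaussianOf_ne_zero {n : ℕ} (m : Fin n → ℝ) {S : Matrix (Fin n) (Fin n) ℝ}
    (hS : 0 < S.det) : mvGaussianOf n m S ≠ 0 := by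
  intro h
  have hq := measurable_quadForm S⁻¹
  have h0 := lintegral_mvGaussianOf m S (g := fun _ => 1) measurable_const
  rw [h, lintegral_zero_measure, eq_comm, lintegral_eq_zero_iff (by fun_prop)] at h0
  obtain ⟨y, hy⟩ := h0.exists
  have hpos : 0 < (√((2 * π) ^ n * S.det))⁻¹ * Real.exp (-(1 / 2) * (y ⬝ᵥ (S⁻¹ *ᵥ y))) := by
    positivity
  simp only [mul_one, Pi.zero_apply, ENNReal.ofReal_eq_zero] at hy
  exact absurd hy hpos.not_ge

/-! ### Almost sure convergence from summable exponential moments -/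

section AlmostSure

variable {Ω : Type*} [MeasurableSpace Ω] {P : Measure Ω}

theorem ae_eventually_neg_of_summable_exp {G : ℕ → Ω → ℝ} {a : ℕ → ℝ}
    (hG : ∀ n, AEMeasurable (G n) P) (ha : Summable fun n => Real.exp (a n))
    (hint : ∀ n, ∫⁻ ω, ENNReal.ofReal (Real.exp (G n ω)) ∂P = ENNReal.ofReal (Real.exp (a n))) :
    ∀ᵐ ω ∂P, ∀ᶠ n in atTop, G n ω < 0 := by
  have hmeas : ∀ n, AEMeasurable (fun ω => ENNReal.ofReal (Real.exp (G n ω))) P := fun n =>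
    (Real.measurable_exp.comp_aemeasurable (hG n)).ennreal_ofReal
  have hfin : ∫⁻ ω, ∑' n, ENNReal.ofReal (Real.exp (G n ω)) ∂P ≠ ⊤ := by
    rw [lintegral_tsum hmeas]
    simp_rw [hint]
    exact ha.tsum_ofReal_ne_top
  filter_upwards [ae_lt_top' (AEMeasurable.tsum hmeas) hfin] with ω hω
  have h := ENNReal.tendsto_atTop_zero_of_tsum_ne_top hω.ne
  filter_upwards [h.eventually_lt_const zero_lt_one] with n hn
  rwa [← ENNReal.ofReal_one, ENNReal.ofReal_lt_ofReal_iff one_pos, Real.exp_lt_one_iff] at hn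

theorem ae_tendsto_of_forall_ae_eventually {f : ℕ → Ω → ℝ} {x : ℝ}
    (h : ∀ ε > 0, ∀ᵐ ω ∂P, ∀ᶠ n in atTop, |f n ω - x| < ε) :
    ∀ᵐ ω ∂P, Tendsto (fun n => f n ω) atTop (nhds x) := by
  have h' := ae_all_iff.2 fun k : ℕ => h (1 / ((k : ℝ) + 1)) Nat.one_div_pos_of_nat
  filter_upwards [h'] with ω hω
  refine Metric.tendsto_nhds.2 fun ε hε => ?_
  obtain ⟨k, hk⟩ := exists_nat_one_div_lt hε
  filter_upwards [hω k] with n hn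
  exact hn.trans hk

/-- Chernoff bound plus Borel–Cantelli for centred Gaussian variables `U n` of variance `T n`. -/
theorem ae_eventually_abs_lt_of_gaussian {U : ℕ → Ω → ℝ} {T s : ℕ → ℝ}
    (hU : ∀ n, AEMeasurable (U n) P)
    (hint : ∀ n (r : ℝ), ∫⁻ ω, ENNReal.ofReal (Real.exp (r * U n ω)) ∂P =
      ENNReal.ofReal (Real.exp (r ^ 2 * T n / 2)))
    (hs : ∀ n, 0 < s n) (hsum : Summable fun n => Real.exp (-(s n ^ 2 * T n / 2))) :
    ∀ᵐ ω ∂P, ∀ᶠ n in atTop, |U n ω| < s n * T n := by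
  have key : ∀ δ : ℝ, δ ^ 2 = 1 → ∀ᵐ ω ∂P, ∀ᶠ n in atTop,
      δ * s n * U n ω + -(s n ^ 2 * T n) < 0 := by
    intro δ hδ
    refine ae_eventually_neg_of_summable_exp (fun n => ((hU n).const_mul _).add_const _) hsum
      fun n => ?_
    simp_rw [Real.exp_add, ENNReal.ofReal_mul (Real.exp_nonneg _)]
    rw [lintegral_mul_const' _ _ ENNReal.ofReal_ne_top, hint,
      ← ENNReal.ofReal_mul (Real.exp_nonneg _), ← Real.exp_add, mul_pow, hδ]
    congr 2
    ring
  filter_upwards [key 1 (by norm_num), key (-1) (by norm_num)] with ω h1 h2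
  filter_upwards [h1, h2] with n h1 h2
  refine abs_lt.2 ⟨?_, ?_⟩ <;> refine lt_of_mul_lt_mul_left ?_ (hs n).le <;> nlinarith

theorem summable_exp_neg_mul_nat_add_one {d : ℝ} (hd : 0 < d) :
    Summable fun n : ℕ => Real.exp (-(d * ((n + 1 : ℕ) : ℝ))) := by
  have h := (Real.summable_exp_nat_mul_iff (a := -d)).2 (by linarith)
  refine ((summable_nat_add_iff 1).2 h).congr fun n => ?_
  congr 1
  ring

theorem summable_exp_neg_mul_rpow {d γ : ℝ} (hd : 0 < d) (hγ : 0 < γ) :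
    Summable fun n : ℕ => Real.exp (-(d * ((n + 1 : ℕ) : ℝ) ^ γ)) := by
  have h : Summable fun n : ℕ => Real.exp (-d * (n : ℝ) ^ γ) := by
    refine summable_of_isBigO_nat (g := fun n : ℕ => (n : ℝ) ^ (-2 : ℝ))
      (Real.summable_nat_rpow.2 (by norm_num)) ?_
    have h1 := ((isLittleO_exp_neg_mul_rpow_atTop hd (-2 / γ)).comp_tendsto
      ((tendsto_rpow_atTop hγ).comp tendsto_natCast_atTop_atTop)).isBigO
    refine h1.congr (fun n => rfl) fun n => ?_
    simp only [Function.comp_apply]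
    rw [← Real.rpow_mul (Nat.cast_nonneg n), mul_div_cancel₀ _ hγ.ne']
  refine ((summable_nat_add_iff 1).2 h).congr fun n => ?_
  rw [neg_mul]

/-- The strong law for chi-squared variables `Q n` with `n + 1` degrees of freedom, from their
Laplace transforms. -/
theorem ae_tendsto_div_of_chiSq {Q : ℕ → Ω → ℝ} (hQ : ∀ n, AEMeasurable (Q n) P)
    (hint : ∀ n (l : ℝ), 0 < l →
      ∫⁻ ω, ENNReal.ofReal (Real.exp ((1 - (l⁻¹) ^ 2) / 2 * Q n ω)) ∂P =
        ENNReal.ofReal (l ^ (n + 1))) :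
    ∀ᵐ ω ∂P, Tendsto (fun n => Q n ω / ((n + 1 : ℕ) : ℝ)) atTop (nhds 1) := by
  have key : ∀ l : ℝ, 0 < l → l ^ 2 ≠ 1 → ∀ᵐ ω ∂P, ∀ᶠ n in atTop,
      (1 - (l⁻¹) ^ 2) / 2 * Q n ω + -(((n + 1 : ℕ) : ℝ) * (l ^ 2 - 1) / 2) < 0 := by
    intro l hl hl1
    have hd : 0 < (l ^ 2 - 1 - Real.log (l ^ 2)) / 2 := by
      have := Real.log_lt_sub_one_of_pos (pow_pos hl 2) hl1
      linarith
    refine ae_eventually_neg_of_summable_exp (fun n => ((hQ n).const_mul _).add_const _)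
      (summable_exp_neg_mul_nat_add_one hd) fun n => ?_
    simp_rw [Real.exp_add, ENNReal.ofReal_mul (Real.exp_nonneg _)]
    rw [lintegral_mul_const' _ _ ENNReal.ofReal_ne_top, hint n l hl,
      ← ENNReal.ofReal_mul (by positivity), ← Real.exp_log (pow_pos hl (n + 1)), ← Real.exp_add,
      Real.log_pow, Real.log_pow]
    congr 2
    push_cast
    ring
  refine ae_tendsto_of_forall_ae_eventually fun ε hε => ?_
  set δ := min ε (1 / 2) with hδ
  have hδ0 : 0 < δ := by positivity
  have hδ1 : δ ≤ 1 / 2 := min_le_right _ _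
  have hup := key (√(1 + δ)) (by positivity) (by rw [Real.sq_sqrt (by linarith)]; linarith)
  have hlo := key (√(1 - δ)) (Real.sqrt_pos.2 (by linarith))
    (by rw [Real.sq_sqrt (by linarith)]; linarith)
  rw [inv_pow, Real.sq_sqrt (by linarith)] at hup hlo
  filter_upwards [hup, hlo] with ω h1 h2
  filter_upwards [h1, h2] with n h1 h2
  have hn : (0 : ℝ) < ((n + 1 : ℕ) : ℝ) := by positivity
  have e1 : 1 - (1 + δ)⁻¹ = δ / (1 + δ) := by field_simp; ring
  have e2 : 1 - (1 - δ)⁻¹ = -(δ / (1 - δ)) := by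
    have : 1 - δ ≠ 0 := by linarith
    field_simp
    ring
  rw [e1] at h1
  rw [e2] at h2
  have hup : Q n ω < (1 + δ) * ((n + 1 : ℕ) : ℝ) := by
    have h3 : δ / (1 + δ) * Q n ω < δ / (1 + δ) * ((1 + δ) * ((n + 1 : ℕ) : ℝ)) := by
      have : δ / (1 + δ) * ((1 + δ) * ((n + 1 : ℕ) : ℝ)) = δ * ((n + 1 : ℕ) : ℝ) := by field_simp
      rw [this]
      linarith
    exact lt_of_mul_lt_mul_left h3 (by positivity)
  have hlo : (1 - δ) * ((n + 1 : ℕ) : ℝ) < Q n ω := by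
    have hδ' : 0 < 1 - δ := by linarith
    have h3 : δ / (1 - δ) * ((1 - δ) * ((n + 1 : ℕ) : ℝ)) < δ / (1 - δ) * Q n ω := by
      have : δ / (1 - δ) * ((1 - δ) * ((n + 1 : ℕ) : ℝ)) = δ * ((n + 1 : ℕ) : ℝ) := by field_simp
      rw [this]
      linarith
    exact lt_of_mul_lt_mul_left h3 (by positivity)
  refine lt_of_lt_of_le (abs_lt.2 ⟨?_, ?_⟩) (min_le_left ε (1 / 2))
  · have := (lt_div_iff₀ hn).2 hlo
    linarith
  · have := (div_lt_iff₀ hn).2 hup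
    linarith

end AlmostSure

/-! ### The estimators in terms of the centred observations -/

theorem muHat_eq_add {n : ℕ} {V : Matrix (Fin n) (Fin n) ℝ} {t x : Fin n → ℝ} (μ : ℝ)
    (ht : t ⬝ᵥ (V⁻¹ *ᵥ t) ≠ 0) :
    muHat n V t x = μ + (t ⬝ᵥ (V⁻¹ *ᵥ (x - μ • t))) / (t ⬝ᵥ (V⁻¹ *ᵥ t)) := by
  simp only [muHat, mulVec_sub, mulVec_smul, dotProduct_sub, dotProduct_smul, smul_eq_mul]
  field_simp
  ring

theorem sigmaHatSq_eq {n : ℕ} {V : Matrix (Fin n) (Fin n) ℝ} (hV : V⁻¹.IsSymm)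
    {t x : Fin n → ℝ} (μ : ℝ) (ht : t ⬝ᵥ (V⁻¹ *ᵥ t) ≠ 0) :
    sigmaHatSq n V t x = ((x - μ • t) ⬝ᵥ (V⁻¹ *ᵥ (x - μ • t))) / n -
      (t ⬝ᵥ (V⁻¹ *ᵥ (x - μ • t))) ^ 2 / (n * (t ⬝ᵥ (V⁻¹ *ᵥ t))) := by
  rw [quadForm_sub_smul hV]
  simp only [sigmaHatSq, mulVec_sub, mulVec_smul, dotProduct_sub, dotProduct_smul, smul_eq_mul]
  rcases eq_or_ne (n : ℝ) 0 with hn | hn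
  · simp [hn]
  · field_simp
    ring

theorem posDef_inv_smul {n : ℕ} {V : Matrix (Fin n) (Fin n) ℝ} (hV : V.PosDef) {a : ℝ}
    (ha : a ≠ 0) : (a • V)⁻¹ = a⁻¹ • V⁻¹ :=
  Matrix.inv_smul' V (Units.mk0 a ha) ((isUnit_iff_isUnit_det _).1 hV.isUnit)

theorem mle_strongly_consistent
    (R : ℝ → ℝ → ℝ) (hsymm : ∀ s u : ℝ, 0 ≤ s → 0 ≤ u → R s u = R u s)
    (c : ℝ) (hc : 0 < c) (β : ℝ) (hβ : β < 2)
    (hyp1 : ∀ u : ℝ, 0 ≤ u → R u u ≤ c * u ^ β)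
    (hyp2 : ∀ (m : ℕ) (s : Fin m → ℝ), (∀ i, 0 < s i) → StrictMono s →
      (Matrix.of fun i j => R (s i) (s j)).PosDef)
    (t : ℕ → ℝ) (htpos : ∀ k : ℕ, 1 ≤ k → 0 < t k) (htmono : StrictMono t)
    (α c₁ c₂ : ℝ) (hα : 0 < α) (hc₁ : 0 < c₁) (hc₁₂ : c₁ ≤ c₂)
    (hgrow : ∀ k : ℕ, 1 ≤ k →
      c₁ * (k : ℝ) ^ α ≤ t k ∧ t k ≤ c₂ * (k : ℝ) ^ α)
    {Ω : Type*} [MeasureSpace Ω] [IsProbabilityMeasure (volume : Measure Ω)]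
    (X : ℝ → Ω → ℝ) (μ σ : ℝ) (hσ : 0 < σ)
    (hlaw : ∀ n : ℕ, 1 ≤ n →
      Measure.map (fun ω => fun i : Fin n => X (t ((i : ℕ) + 1)) ω) (volume : Measure Ω) =
        mvGaussianOf n (fun i => μ * t ((i : ℕ) + 1)) (σ ^ 2 • covMat R t n)) :
    (∀ᵐ ω ∂(volume : Measure Ω),
      Tendsto (fun n : ℕ =>
          muHat n (covMat R t n) (tVec t n) (fun i => X (t ((i : ℕ) + 1)) ω))
        atTop (nhds μ)) ∧
    (∀ᵐ ω ∂(volume : Measure Ω),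
      Tendsto (fun n : ℕ =>
          sigmaHatSq n (covMat R t n) (tVec t n) (fun i => X (t ((i : ℕ) + 1)) ω))
        atTop (nhds (σ ^ 2))) := by
  set P : Measure Ω := volume
  set V : ∀ n : ℕ, Matrix (Fin n) (Fin n) ℝ := covMat R t with hVdef
  set τ : ∀ n : ℕ, Fin n → ℝ := tVec t with hτdef
  set Z : ∀ n : ℕ, Ω → Fin n → ℝ := fun n ω i => X (t ((i : ℕ) + 1)) ω with hZdef
  have hσ2 : σ ^ 2 ≠ 0 := by positivity
  have hV : ∀ n, (V n).PosDef := fun n => hyp2 n (τ n) (fun i => htpos _ (by omega))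
    fun i j hij => htmono (by simpa using hij)
  have hVs : ∀ n, (V n)⁻¹.IsSymm := fun n => isSymm_inv_of_posDef (hV n)
  have hSinv : ∀ n, (σ ^ 2 • V n)⁻¹ = (σ ^ 2)⁻¹ • (V n)⁻¹ := fun n => posDef_inv_smul (hV n) hσ2
  have hSs : ∀ n, (σ ^ 2 • V n)⁻¹.IsSymm := fun n => by
    rw [hSinv]
    exact (hVs n).smul _
  have hlaw' : ∀ n, Measure.map (Z (n + 1)) P =
      mvGaussianOf (n + 1) (μ • τ (n + 1)) (σ ^ 2 • V (n + 1)) := fun n => hlaw (n + 1) (by omega)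
  have hZ : ∀ n, AEMeasurable (Z (n + 1)) P := fun n => by
    by_contra hne
    refine mvGaussianOf_ne_zero (μ • τ (n + 1)) (S := σ ^ 2 • V (n + 1)) ?_ ?_
    · rw [det_smul]
      exact mul_pos (by positivity) (hV _).det_pos
    · rw [← hlaw', Measure.map_of_not_aemeasurable hne]
  have hprob : ∀ n, IsProbabilityMeasure
      (mvGaussianOf (n + 1) (μ • τ (n + 1)) (σ ^ 2 • V (n + 1))) := fun n => by
    rw [← hlaw']
    exact Measure.isProbabilityMeasure_map (hZ n)
  -- The centred observations, the information `T`, and the two normalized statistics.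
  set Y : ∀ n : ℕ, Ω → Fin (n + 1) → ℝ := fun n ω => Z (n + 1) ω - μ • τ (n + 1) with hYdef
  set T : ℕ → ℝ := fun n => τ (n + 1) ⬝ᵥ ((V (n + 1))⁻¹ *ᵥ τ (n + 1)) with hTdef
  set A : ℕ → Ω → ℝ := fun n ω => τ (n + 1) ⬝ᵥ ((V (n + 1))⁻¹ *ᵥ Y n ω) with hAdef
  set q : ℕ → Ω → ℝ := fun n ω => Y n ω ⬝ᵥ ((V (n + 1))⁻¹ *ᵥ Y n ω) with hqdef
  have hY : ∀ n, AEMeasurable (Y n) P := fun n => (hZ n).sub_const _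
  have hA : ∀ n, AEMeasurable (fun ω => A n ω / σ ^ 2) P := fun n =>
    ((measurable_dotProduct_mulVec _ _).comp_aemeasurable (hY n)).div_const _
  have hq : ∀ n, AEMeasurable (fun ω => q n ω / σ ^ 2) P := fun n =>
    ((measurable_quadForm _).comp_aemeasurable (hY n)).div_const _
  have hAint : ∀ n (r : ℝ), ∫⁻ ω, ENNReal.ofReal (Real.exp (r * (A n ω / σ ^ 2))) ∂P =
      ENNReal.ofReal (Real.exp (r ^ 2 * (T n / σ ^ 2) / 2)) := by
    intro n r
    have := hprob n
    have hl := measurable_dotProduct_mulVec (σ ^ 2 • V (n + 1))⁻¹ (τ (n + 1))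
    have h := lintegral_exp_linear_mvGaussianOf (μ • τ (n + 1)) (hSs (n + 1)) (τ (n + 1)) r
    rw [← hlaw', lintegral_map' (Measurable.aemeasurable ?_) (hZ n)] at h
    · simpa only [hSinv, smul_mulVec, dotProduct_smul, smul_eq_mul, ← div_eq_inv_mul] using h
    · exact (Real.measurable_exp.comp ((hl.comp (measurable_id.sub_const _)).const_mul r)).ennreal_ofReal
  have hqint : ∀ n (l : ℝ), 0 < l →
      ∫⁻ ω, ENNReal.ofReal (Real.exp ((1 - (l⁻¹) ^ 2) / 2 * (q n ω / σ ^ 2))) ∂P =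
        ENNReal.ofReal (l ^ (n + 1)) := by
    intro n l hl
    have := hprob n
    have hm := measurable_quadForm (σ ^ 2 • V (n + 1))⁻¹
    have h := lintegral_exp_quadForm_mvGaussianOf (μ • τ (n + 1)) (σ ^ 2 • V (n + 1)) hl
    rw [← hlaw', lintegral_map' (Measurable.aemeasurable ?_) (hZ n)] at h
    · simpa only [hSinv, smul_mulVec, dotProduct_smul, smul_eq_mul, ← div_eq_inv_mul] using h
    · exact (Real.measurable_exp.comp ((hm.comp (measurable_id.sub_const _)).const_mul _)).ennreal_ofReal
  have hγ : 0 < α * (2 - β) := mul_pos hα (by linarith)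
  have hTlow : ∀ n, c₁ ^ (2 - β) / c * ((n + 1 : ℕ) : ℝ) ^ (α * (2 - β)) ≤ T n := by
    intro n
    have htn : 0 < t (n + 1) := htpos _ (by omega)
    have hdiag : V (n + 1) (Fin.last n) (Fin.last n) ≤ c * t (n + 1) ^ β := by
      simpa [hVdef, covMat] using hyp1 (t (n + 1)) htn.le
    have hdpos : 0 < V (n + 1) (Fin.last n) (Fin.last n) := (hV _).diag_pos
    calc c₁ ^ (2 - β) / c * ((n + 1 : ℕ) : ℝ) ^ (α * (2 - β))
        = (c₁ * ((n + 1 : ℕ) : ℝ) ^ α) ^ (2 - β) / c := by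
          rw [Real.mul_rpow hc₁.le (by positivity), ← Real.rpow_mul (by positivity)]
          ring
      _ ≤ t (n + 1) ^ (2 - β) / c := by
          gcongr
          exact (hgrow (n + 1) (by omega)).1
      _ = t (n + 1) ^ 2 / (c * t (n + 1) ^ β) := by
          rw [Real.rpow_sub htn, Real.rpow_two]
          field_simp
      _ ≤ t (n + 1) ^ 2 / V (n + 1) (Fin.last n) (Fin.last n) := by gcongr
      _ ≤ T n := by
          simpa [hτdef, tVec] using sq_div_diag_le_quadForm_inv (hV (n + 1)) (τ (n + 1)) (Fin.last n)
  have hTpos : ∀ n, 0 < T n := fun n => lt_of_lt_of_le (by positivity) (hTlow n)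
  have hmu : ∀ᵐ ω ∂P, Tendsto (fun n => A n ω / T n) atTop (nhds 0) := by
    refine ae_tendsto_of_forall_ae_eventually fun ε hε => ?_
    have h := ae_eventually_abs_lt_of_gaussian (s := fun _ => ε) hA hAint (fun _ => hε) ?_
    · filter_upwards [h] with ω hω
      filter_upwards [hω] with n hn
      rw [sub_zero, abs_div, abs_of_pos (hTpos n), div_lt_iff₀ (hTpos n)]
      rw [abs_div, abs_of_pos (by positivity : 0 < σ ^ 2), ← mul_div_assoc] at hn
      exact (div_lt_div_iff_of_pos_right (by positivity)).1 hn
    · refine (summable_exp_neg_mul_rpow (d := ε ^ 2 / (2 * σ ^ 2) * (c₁ ^ (2 - β) / c))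
        (by positivity) hγ).of_nonneg_of_le (fun _ => by positivity) fun n => ?_
      rw [Real.exp_le_exp, neg_le_neg_iff, mul_assoc]
      calc _ ≤ ε ^ 2 / (2 * σ ^ 2) * T n := by gcongr; exact hTlow n
        _ = _ := by field_simp
  have hproj : ∀ᵐ ω ∂P, Tendsto (fun n => A n ω ^ 2 / (((n + 1 : ℕ) : ℝ) * T n)) atTop
      (nhds 0) := by
    refine ae_tendsto_of_forall_ae_eventually fun ε hε => ?_
    have hsq : ∀ n : ℕ, √(ε * ((n + 1 : ℕ) : ℝ) / T n) ^ 2 = ε * ((n + 1 : ℕ) : ℝ) / T n :=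
      fun n => Real.sq_sqrt (by have := hTpos n; positivity)
    have h := ae_eventually_abs_lt_of_gaussian
      (s := fun n => √(ε * ((n + 1 : ℕ) : ℝ) / T n)) hA hAint
      (fun n => by have := hTpos n; positivity) ?_
    · filter_upwards [h] with ω hω
      filter_upwards [hω] with n hn
      have hT := hTpos n
      rw [sub_zero, abs_of_nonneg (by positivity), div_lt_iff₀ (by positivity)]
      rw [abs_div, abs_of_pos (by positivity : 0 < σ ^ 2), ← mul_div_assoc] at hn
      have hn' := (div_lt_div_iff_of_pos_right (by positivity)).1 hn
      have h2 := pow_lt_pow_left₀ hn' (abs_nonneg _) two_ne_zero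
      rw [sq_abs, mul_pow, hsq] at h2
      calc _ < _ := h2
        _ = _ := by field_simp
    · refine (summable_exp_neg_mul_nat_add_one (d := ε / (2 * σ ^ 2))
        (by positivity)).congr fun n => ?_
      have hT := hTpos n
      rw [hsq]
      congr 2
      field_simp
  have hchi := ae_tendsto_div_of_chiSq hq hqint
  refine ⟨?_, ?_⟩
  · filter_upwards [hmu] with ω hω
    refine (tendsto_add_atTop_iff_nat 1).1 ?_
    have h := hω.const_add μ
    rw [add_zero] at h
    exact h.congr fun n => (muHat_eq_add μ (hTpos n).ne').symm
  · filter_upwards [hproj, hchi] with ω h1 h2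
    refine (tendsto_add_atTop_iff_nat 1).1 ?_
    have h := (h2.const_mul (σ ^ 2)).sub h1
    rw [mul_one, sub_zero] at h
    refine h.congr fun n => ?_
    rw [sigmaHatSq_eq (hVs (n + 1)) μ (hTpos n).ne']
    congr 1
    field_simp
    rfl
end
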